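/- Let n, m ≥ 1 and let Ω : (ℝⁿ)^m → ℝ satisfy: Ω(λy⃗) = Ω(y⃗) for all λ > 0; |Ω(ξ⃗) − Ω(η⃗)| ≤ C₀|ξ⃗′ − η⃗′|^β for some 0 < β < 1 and C₀ > 0; and ∫_{S^{n−1}} Ω(y₁,…,y_m) dσ(y_j) = 0 for each j = 1,…,m. Let f₁,…,f_m ∈ BMO(ℝⁿ). For a ball B = B(x₀,r), define the truncated square function μ^∞(f⃗)(x) = (∫_{8r}^∞ |F_t(f⃗)(x)|² dt/t)^{1/2}. Then there is C > 0, independent of f⃗, B and r, such that for all x, z ∈ B, |μ^∞(f⃗)(x) − μ^∞(f⃗)(z)| ≤ C ∏_{j=1}^m ‖f_j‖_{BMO}. -/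

import Mathlib

open MeasureTheory Metric ENNReal

noncomputable def ballAvg (n : ℕ) (f : EuclideanSpace ℝ (Fin n) → ℝ)
    (c : EuclideanSpace ℝ (Fin n)) (r : ℝ) : ℝ :=
  (volume (closedBall c r)).toReal⁻¹ * ∫ y in closedBall c r, f y

noncomputable def bmoNorm (n : ℕ) (f : EuclideanSpace ℝ (Fin n) → ℝ) : ℝ≥0∞ :=
  ⨆ (c : EuclideanSpace ℝ (Fin n)) (r : ℝ) (_ : 0 < r),
    ENNReal.ofReal ((volume (closedBall c r)).toReal⁻¹ *
      ∫ y in closedBall c r, |f y - ballAvg n f c r|)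

noncomputable def campanatoNorm (n : ℕ) (α p : ℝ) (f : EuclideanSpace ℝ (Fin n) → ℝ) : ℝ≥0∞ :=
  ⨆ (c : EuclideanSpace ℝ (Fin n)) (r : ℝ) (_ : 0 < r),
    ENNReal.ofReal ((volume (closedBall c r)).toReal ^ (-(α / n)) *
      ((volume (closedBall c r)).toReal⁻¹ *
        ∫ y in closedBall c r, |f y - ballAvg n f c r| ^ p) ^ (1 / p))

noncomputable def campanato1Norm (n : ℕ) (α : ℝ) (f : EuclideanSpace ℝ (Fin n) → ℝ) : ℝ≥0∞ :=
  ⨆ (c : EuclideanSpace ℝ (Fin n)) (r : ℝ) (_ : 0 < r),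
    ENNReal.ofReal ((volume (closedBall c r)).toReal ^ (-(α / n)) *
      ((volume (closedBall c r)).toReal⁻¹ *
        ∫ y in closedBall c r, |f y - ballAvg n f c r|))

noncomputable def lipNorm (n : ℕ) (γ : ℝ) (f : EuclideanSpace ℝ (Fin n) → ℝ) : ℝ≥0∞ :=
  ⨆ (x : EuclideanSpace ℝ (Fin n)) (y : EuclideanSpace ℝ (Fin n)) (_ : x ≠ y),
    ENNReal.ofReal (|f x - f y| / ‖x - y‖ ^ γ)

noncomputable def mFt (n m : ℕ) (Ω : (Fin m → EuclideanSpace ℝ (Fin n)) → ℝ)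
    (f : Fin m → EuclideanSpace ℝ (Fin n) → ℝ) (t : ℝ) (x : EuclideanSpace ℝ (Fin n)) : ℝ :=
  t ^ (-(m : ℝ)) * ∫ y in Set.univ.pi fun _ : Fin m => closedBall (0 : EuclideanSpace ℝ (Fin n)) t,
    Ω y / (∑ j, ‖y j‖) ^ ((m : ℝ) * ((n : ℝ) - 1)) * ∏ i, f i (x - y i)

noncomputable def marc (n m : ℕ) (Ω : (Fin m → EuclideanSpace ℝ (Fin n)) → ℝ)
    (f : Fin m → EuclideanSpace ℝ (Fin n) → ℝ) (x : EuclideanSpace ℝ (Fin n)) : ℝ≥0∞ :=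
  (∫⁻ t in Set.Ioi (0 : ℝ), ENNReal.ofReal ((mFt n m Ω f t x) ^ 2 / t)) ^ (1 / 2 : ℝ)

noncomputable def marcTail (n m : ℕ) (Ω : (Fin m → EuclideanSpace ℝ (Fin n)) → ℝ)
    (f : Fin m → EuclideanSpace ℝ (Fin n) → ℝ) (r : ℝ) (x : EuclideanSpace ℝ (Fin n)) : ℝ≥0∞ :=
  (∫⁻ t in Set.Ioi (8 * r : ℝ), ENNReal.ofReal ((mFt n m Ω f t x) ^ 2 / t)) ^ (1 / 2 : ℝ)



lemma vol_cb (n : ℕ) (c : EuclideanSpace ℝ (Fin n)) (s : ℝ) (hs : 0 ≤ s) :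
    volume (closedBall c s) = ENNReal.ofReal (s ^ n) * volume (closedBall (0 : EuclideanSpace ℝ (Fin n)) 1) := by
  rw [Measure.addHaar_closedBall' volume c hs]
  simp

lemma vol_one_pos (n : ℕ) : 0 < (volume (closedBall (0 : EuclideanSpace ℝ (Fin n)) 1)).toReal := by
  apply ENNReal.toReal_pos
  · exact (measure_closedBall_pos volume _ one_pos).ne'
  · exact measure_closedBall_lt_top.ne

lemma vol_cb_real (n : ℕ) (c : EuclideanSpace ℝ (Fin n)) (s : ℝ) (hs : 0 ≤ s) :
    (volume (closedBall c s)).toReal = s ^ n * (volume (closedBall (0 : EuclideanSpace ℝ (Fin n)) 1)).toReal := by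
  rw [vol_cb n c s hs, ENNReal.toReal_mul, ENNReal.toReal_ofReal (by positivity)]

lemma locint_on {n : ℕ} {f : EuclideanSpace ℝ (Fin n) → ℝ} (hf : LocallyIntegrable f volume)
    (c : EuclideanSpace ℝ (Fin n)) (s : ℝ) : IntegrableOn f (closedBall c s) volume :=
  hf.integrableOn_isCompact (isCompact_closedBall c s)

lemma const_on {n : ℕ} (a : ℝ)
    (c : EuclideanSpace ℝ (Fin n)) (s : ℝ) : Integrable (fun _ => a) (volume.restrict (closedBall c s)) :=
  integrableOn_const measure_closedBall_lt_top.ne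

lemma bmo_bound {n : ℕ} {f : EuclideanSpace ℝ (Fin n) → ℝ}
    (hb : bmoNorm n f < ⊤) (c : EuclideanSpace ℝ (Fin n)) (s : ℝ) (hs : 0 < s) :
    ∫ y in closedBall c s, |f y - ballAvg n f c s| ≤
      (volume (closedBall c s)).toReal * (bmoNorm n f).toReal := by
  have h1 : ENNReal.ofReal ((volume (closedBall c s)).toReal⁻¹ *
      ∫ y in closedBall c s, |f y - ballAvg n f c s|) ≤ bmoNorm n f := by
    unfold bmoNorm
    exact le_iSup₂_of_le c s (le_iSup_of_le hs le_rfl)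
  have h2 := (ENNReal.ofReal_le_iff_le_toReal hb.ne).1 h1
  have hv : 0 < (volume (closedBall c s)).toReal := by
    rw [vol_cb_real n c s hs.le]; have := vol_one_pos n; positivity
  rwa [inv_mul_le_iff₀ hv] at h2

/-- oscillation over a sub-ball -/
lemma avg_sub_ball {n : ℕ} {f : EuclideanSpace ℝ (Fin n) → ℝ} (hf : LocallyIntegrable f volume)
    (w : EuclideanSpace ℝ (Fin n)) (s : ℝ) (hs : 0 < s) (c : ℝ) :
    |ballAvg n f w s - c| ≤ (volume (closedBall w s)).toReal⁻¹ * ∫ y in closedBall w s, |f y - c| := by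
  have hv : 0 < (volume (closedBall w s)).toReal := by
    rw [vol_cb_real n w s hs.le]; have := vol_one_pos n; positivity
  have hi := locint_on hf w s
  have : ballAvg n f w s - c = (volume (closedBall w s)).toReal⁻¹ * ∫ y in closedBall w s, (f y - c) := by
    rw [integral_sub hi (const_on _ _ _), ballAvg]
    simp [Measure.real]
    field_simp
  rw [this, abs_mul, abs_of_pos (inv_pos.2 hv)]
  gcongr
  exact abs_integral_le_integral_abs

lemma avg_diff {n : ℕ} {f : EuclideanSpace ℝ (Fin n) → ℝ} (hf : LocallyIntegrable f volume)
    (hb : bmoNorm n f < ⊤) (w c : EuclideanSpace ℝ (Fin n)) (s S : ℝ) (hs : 0 < s) (hS : 0 < S)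
    (hsub : closedBall w s ⊆ closedBall c S) :
    |ballAvg n f w s - ballAvg n f c S| ≤ (S / s) ^ n * (bmoNorm n f).toReal := by
  refine (avg_sub_ball hf w s hs _).trans ?_
  have hV := vol_one_pos n
  have h1 : ∫ y in closedBall w s, |f y - ballAvg n f c S| ≤
      ∫ y in closedBall c S, |f y - ballAvg n f c S| := by
    apply setIntegral_mono_set
    · exact ((locint_on hf c S).sub (const_on _ _ _)).abs
    · filter_upwards with y using abs_nonneg _
    · exact hsub.eventuallyLE
  have h2 := h1.trans (bmo_bound hb c S hS)
  rw [vol_cb_real n c S hS.le] at h2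
  rw [vol_cb_real n w s hs.le]
  calc _ ≤ (s ^ n * (volume (closedBall (0 : EuclideanSpace ℝ (Fin n)) 1)).toReal)⁻¹ *
      (S ^ n * (volume (closedBall (0 : EuclideanSpace ℝ (Fin n)) 1)).toReal * (bmoNorm n f).toReal) := by
        gcongr
    _ = _ := by rw [div_pow]; field_simp

/-- avg growth -/
lemma avg_growth (n : ℕ) (δ : ℝ) (hδ : 0 < δ) : ∃ A > (0:ℝ),
    ∀ f : EuclideanSpace ℝ (Fin n) → ℝ, LocallyIntegrable f volume → bmoNorm n f < ⊤ →
    ∀ (x₀ : EuclideanSpace ℝ (Fin n)) (t : ℝ), 0 < t → ∀ w, dist w x₀ ≤ 2 * t → ∀ s, 0 < s → s ≤ t →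
    |ballAvg n f w s - ballAvg n f x₀ (4 * t)| ≤ A * (t / s) ^ δ * (bmoNorm n f).toReal := by
  have h2δ : (2:ℝ) ^ (-δ) < 1 := by
    apply Real.rpow_lt_one_of_one_lt_of_neg <;> linarith
  refine ⟨8 ^ n / (1 - 2 ^ (-δ)), div_pos (by positivity) (by linarith), ?_⟩
  intro f hf hb x₀ t ht w hw
  set N := (bmoNorm n f).toReal
  have hN : 0 ≤ N := ENNReal.toReal_nonneg
  set A : ℝ := 8 ^ n / (1 - 2 ^ (-δ)) with hA
  have hA1 : A * (1 - 2 ^ (-δ)) = 8 ^ n := by rw [hA]; field_simp [show (1 - (2:ℝ) ^ (-δ)) ≠ 0 by linarith]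
  have hA8 : 8 ^ n ≤ A := by
    rw [hA, le_div_iff₀ (by linarith)]
    have : (0:ℝ) < 2 ^ (-δ) := by positivity
    nlinarith [show (0:ℝ) < 8 ^ n by positivity]
  have key : ∀ k : ℕ, ∀ s, 0 < s → s ≤ t → t < 2 ^ (k + 1) * s →
    |ballAvg n f w s - ballAvg n f x₀ (4 * t)| ≤ A * (t / s) ^ δ * N := by
    intro k
    induction k with
    | zero =>
      intro s hs hst hk
      have h1 := avg_diff hf hb w x₀ s (4 * t) hs (by linarith) (closedBall_subset_closedBall' (by linarith))
      refine h1.trans ?_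
      gcongr
      have h2 : 4 * t / s ≤ 8 := by rw [div_le_iff₀ hs]; rw [zero_add, pow_one] at hk; linarith
      have h3 : (1:ℝ) ≤ (t / s) ^ δ := Real.one_le_rpow (by rw [le_div_iff₀ hs]; linarith) hδ.le
      calc (4 * t / s) ^ n ≤ 8 ^ n := by gcongr
        _ ≤ A := hA8
        _ ≤ A * (t / s) ^ δ := le_mul_of_one_le_right (by linarith [show (0:ℝ) < 8 ^ n by positivity]) h3
    | succ k ih =>
      intro s hs hst hk
      by_cases h : t < 2 ^ (k + 1) * s
      · exact ih s hs hst h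
      push Not at h
      have h2s : 2 * s ≤ t := by
        refine le_trans ?_ h
        gcongr
        exact le_self_pow₀ (by norm_num) (by omega)
      have h1 := ih (2 * s) (by linarith) h2s (by rw [pow_succ] at hk; linarith)
      have h2 := avg_diff hf hb w w s (2 * s) hs (by linarith) (closedBall_subset_closedBall (by linarith))
      have e1 : 2 * s / s = 2 := by field_simp
      rw [e1] at h2
      have h3 : (1:ℝ) ≤ (t / s) ^ δ := Real.one_le_rpow (by rw [le_div_iff₀ hs]; linarith) hδ.le
      have e2 : (t / (2 * s)) ^ δ = (t / s) ^ δ * 2 ^ (-δ) := by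
        rw [show t / (2 * s) = t / s * 2⁻¹ by field_simp, Real.mul_rpow (by positivity) (by positivity),
          Real.inv_rpow (by norm_num), Real.rpow_neg (by norm_num)]
      rw [e2] at h1
      have h28 : (2:ℝ) ^ n ≤ 8 ^ n := by gcongr; norm_num
      calc |ballAvg n f w s - ballAvg n f x₀ (4 * t)|
          ≤ |ballAvg n f w s - ballAvg n f w (2 * s)| + |ballAvg n f w (2 * s) - ballAvg n f x₀ (4 * t)| := abs_sub_le _ _ _
        _ ≤ 2 ^ n * N + A * ((t / s) ^ δ * 2 ^ (-δ)) * N := add_le_add h2 h1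
        _ = (2 ^ n + A * (t / s) ^ δ * 2 ^ (-δ)) * N := by ring
        _ ≤ (A * (1 - 2 ^ (-δ)) * (t / s) ^ δ + A * (t / s) ^ δ * 2 ^ (-δ)) * N := by
            gcongr
            rw [hA1]
            refine h28.trans (le_mul_of_one_le_right (by positivity) h3)
        _ = _ := by ring
  intro s hs hst
  obtain ⟨k, hk⟩ := pow_unbounded_of_one_lt (t / s) (one_lt_two (α := ℝ))
  rw [div_lt_iff₀ hs] at hk
  refine key k s hs hst (hk.trans_le ?_)
  gcongr
  · norm_num
  · omega

lemma osc_growth (n : ℕ) (δ : ℝ) (hδ : 0 < δ) : ∃ A > (0:ℝ),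
    ∀ f : EuclideanSpace ℝ (Fin n) → ℝ, LocallyIntegrable f volume → bmoNorm n f < ⊤ →
    ∀ (x₀ : EuclideanSpace ℝ (Fin n)) (t : ℝ), 0 < t → ∀ w, dist w x₀ ≤ 2 * t → ∀ s, 0 < s → s ≤ t →
    ∫⁻ y in closedBall w s, ‖f y - ballAvg n f x₀ (4 * t)‖ₑ ≤
      ENNReal.ofReal (A * (bmoNorm n f).toReal * (s ^ n * (t / s) ^ δ)) := by
  obtain ⟨A, hA, H⟩ := avg_growth n δ hδ
  have hV := vol_one_pos n
  set V := (volume (closedBall (0 : EuclideanSpace ℝ (Fin n)) 1)).toReal with hVdef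
  refine ⟨V * (1 + A), by positivity, ?_⟩
  intro f hf hb x₀ t ht w hw s hs hst
  set N := (bmoNorm n f).toReal
  have hN : 0 ≤ N := ENNReal.toReal_nonneg
  have h3 : (1:ℝ) ≤ (t / s) ^ δ := Real.one_le_rpow (by rw [le_div_iff₀ hs]; linarith) hδ.le
  set c := ballAvg n f x₀ (4 * t)
  have hi : ∀ c : ℝ, Integrable (fun y => f y - c) (volume.restrict (closedBall w s)) := fun c =>
    (locint_on hf w s).sub (const_on _ _ _)
  rw [← ofReal_integral_norm_eq_lintegral_enorm (hi c)]
  apply ENNReal.ofReal_le_ofReal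
  have h1 := bmo_bound hb w s hs
  have h2 := H f hf hb x₀ t ht w hw s hs hst
  rw [vol_cb_real n w s hs.le, ← hVdef] at h1
  calc ∫ y in closedBall w s, ‖f y - c‖ ≤ ∫ y in closedBall w s, (|f y - ballAvg n f w s| + |ballAvg n f w s - c|) := by
        apply integral_mono (hi c).norm ((hi _).abs.add (const_on _ _ _))
        intro y
        simp only [Real.norm_eq_abs]
        exact abs_sub_le _ _ _
    _ = (∫ y in closedBall w s, |f y - ballAvg n f w s|) + s ^ n * V * |ballAvg n f w s - c| := by
        rw [integral_add (hi _).abs (const_on _ _ _)]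
        simp [Measure.real, vol_cb_real n w s hs.le, ← hVdef]
    _ ≤ s ^ n * V * N + s ^ n * V * (A * (t / s) ^ δ * N) := by gcongr
    _ = s ^ n * V * N * (1 + A * (t / s) ^ δ) := by ring
    _ ≤ s ^ n * V * N * ((t / s) ^ δ + A * (t / s) ^ δ) := by gcongr
    _ = _ := by ring


lemma frac_int (n : ℕ) (b δ : ℝ) (hb : 0 ≤ b) (h : b + δ < n) : ∃ C > (0:ℝ),
    ∀ g : EuclideanSpace ℝ (Fin n) → ℝ≥0∞, AEMeasurable g volume →
    ∀ (x : EuclideanSpace ℝ (Fin n)) (t A : ℝ), 0 < t → 0 ≤ A →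
    (∀ s, 0 < s → s ≤ t → ∫⁻ y in closedBall x s, g y ≤ ENNReal.ofReal (A * (s ^ n * (t / s) ^ δ))) →
    ∫⁻ y in closedBall x t, ENNReal.ofReal (‖x - y‖ ^ (-b)) * g y ≤ ENNReal.ofReal (A * (C * t ^ (n - b))) := by
  set q : ℝ := 2 ^ (-(n - b - δ)) with hq
  have hq0 : 0 < q := by positivity
  have hq1 : q < 1 := Real.rpow_lt_one_of_one_lt_of_neg (by norm_num) (by linarith)
  refine ⟨2 ^ b * (1 - q)⁻¹, mul_pos (by positivity) (inv_pos.2 (by linarith)), ?_⟩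
  intro g hg x t A ht hA H
  have hpt : ∀ y ∈ closedBall x t, ENNReal.ofReal (‖x - y‖ ^ (-b)) * g y ≤
      ∑' k : ℕ, ENNReal.ofReal ((t / 2 ^ (k + 1)) ^ (-b)) * (closedBall x (t / 2 ^ k)).indicator g y := by
    intro y hy
    have hy' : ‖x - y‖ ≤ t := by rw [mem_closedBall, dist_comm, dist_eq_norm] at hy; exact hy
    suffices hk : ∃ k : ℕ, ‖x - y‖ ≤ t / 2 ^ k ∧ ‖x - y‖ ^ (-b) ≤ (t / 2 ^ (k + 1)) ^ (-b) by
      obtain ⟨k, h1, h2⟩ := hk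
      refine le_trans ?_ (ENNReal.le_tsum k)
      rw [Set.indicator_of_mem (by rw [mem_closedBall, dist_comm, dist_eq_norm]; exact h1)]
      gcongr
    rcases eq_or_lt_of_le (norm_nonneg (x - y)) with h0 | h0
    · refine ⟨0, by rw [← h0]; positivity, ?_⟩
      rw [← h0]
      rcases eq_or_lt_of_le hb with hb0 | hb0
      · simp [← hb0]
      · rw [Real.zero_rpow (by linarith)]; positivity
    · obtain ⟨k, h1, h2⟩ := exists_nat_pow_near (show 1 ≤ t / ‖x - y‖ by rwa [le_div_iff₀ h0, one_mul])
        (one_lt_two (α := ℝ))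
      refine ⟨k, ?_, ?_⟩
      · rw [le_div_iff₀ h0] at h1
        rw [le_div_iff₀ (by positivity)]; linarith
      · apply Real.rpow_le_rpow_of_nonpos (by positivity) _ (by linarith)
        rw [div_lt_iff₀ h0] at h2
        rw [div_le_iff₀ (by positivity)]; linarith
  calc _ ≤ ∫⁻ y in closedBall x t, ∑' k : ℕ, ENNReal.ofReal ((t / 2 ^ (k + 1)) ^ (-b)) * (closedBall x (t / 2 ^ k)).indicator g y :=
        setLIntegral_mono' measurableSet_closedBall hpt
    _ = ∑' k : ℕ, ∫⁻ y in closedBall x t, ENNReal.ofReal ((t / 2 ^ (k + 1)) ^ (-b)) * (closedBall x (t / 2 ^ k)).indicator g y := by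
        apply lintegral_tsum
        intro k
        exact ((hg.indicator measurableSet_closedBall).const_mul _).restrict
    _ ≤ ∑' k : ℕ, ENNReal.ofReal (A * 2 ^ b * t ^ (n - b) * q ^ k) := by
        apply ENNReal.tsum_le_tsum
        intro k
        rw [lintegral_const_mul'' _ (hg.indicator measurableSet_closedBall).restrict]
        have hle : t / 2 ^ k ≤ t := div_le_self ht.le (one_le_pow₀ (by norm_num))
        have h1 : ∫⁻ y in closedBall x t, (closedBall x (t / 2 ^ k)).indicator g y ≤
            ENNReal.ofReal (A * ((t / 2 ^ k) ^ n * (t / (t / 2 ^ k)) ^ δ)) := by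
          refine le_trans (setLIntegral_le_lintegral _ _) ?_
          rw [lintegral_indicator measurableSet_closedBall]
          exact H _ (by positivity) hle
        refine (mul_le_mul_right h1 _).trans ?_
        rw [← ENNReal.ofReal_mul (by positivity)]
        apply ENNReal.ofReal_le_ofReal
        apply le_of_eq
        have e1 : t / (t / 2 ^ k) = (2:ℝ) ^ (k:ℝ) := by rw [Real.rpow_natCast]; field_simp
        have e2 : t / 2 ^ (k + 1) = t * (2:ℝ) ^ (-(k:ℝ) - 1) := by
          rw [Real.rpow_sub (by norm_num), Real.rpow_neg (by norm_num), Real.rpow_natCast, pow_succ]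
          field_simp; simp
        have e3 : (t / 2 ^ k) ^ n = t ^ (n:ℝ) * (2:ℝ) ^ (-(k:ℝ) * n) := by
          rw [Real.rpow_mul (by norm_num), Real.rpow_natCast, Real.rpow_natCast, ← mul_pow,
            Real.rpow_neg (by norm_num), Real.rpow_natCast]; rfl
        have e4 : q ^ k = (2:ℝ) ^ (-(n - b - δ) * k) := by
          rw [Real.rpow_mul (by norm_num), Real.rpow_natCast]
        rw [e1, e2, e3, e4, Real.mul_rpow (by positivity) (by positivity), ← Real.rpow_mul (by norm_num),
          ← Real.rpow_mul (by norm_num), sub_eq_add_neg (n:ℝ) b, Real.rpow_add ht]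
        have : (2:ℝ) ^ ((-(k:ℝ) - 1) * -b) * ((2:ℝ) ^ (-(k:ℝ) * n) * (2:ℝ) ^ (k * δ)) = 2 ^ b * (2:ℝ) ^ (-(↑n + -b - δ) * k) := by
          rw [← Real.rpow_add (by norm_num), ← Real.rpow_add (by norm_num), ← Real.rpow_add (by norm_num)]
          congr 1; ring
        linear_combination (A * t ^ (n:ℝ) * t ^ (-b)) * this
    _ = ENNReal.ofReal (A * (2 ^ b * (1 - q)⁻¹ * t ^ (n - b))) := by
        rw [← ENNReal.ofReal_tsum_of_nonneg (fun k => by positivity)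
          ((summable_geometric_of_lt_one hq0.le hq1).mul_left _), tsum_mul_left, tsum_geometric_of_lt_one hq0.le hq1]
        congr 1; ring

lemma vol_annulus (n : ℕ) (x : EuclideanSpace ℝ (Fin n)) (t r : ℝ) (hr : 0 < r) (hrt : 8 * r ≤ t) :
    volume (closedBall x (t + r) \ ball x (t - 3 * r)) ≤
      ENNReal.ofReal (4 * n * 2 ^ n * (r / t) * t ^ n) * volume (closedBall (0 : EuclideanSpace ℝ (Fin n)) 1) := by
  have ht : 0 < t := by linarith
  have hV : volume (ball (0 : EuclideanSpace ℝ (Fin n)) 1) = volume (closedBall (0 : EuclideanSpace ℝ (Fin n)) 1) := by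
    exact (Measure.addHaar_unitClosedBall_eq_addHaar_unitBall _).symm
  rw [measure_sdiff ((ball_subset_closedBall).trans (closedBall_subset_closedBall (by linarith)))
    measurableSet_ball.nullMeasurableSet measure_ball_lt_top.ne, vol_cb n x _ (by linarith),
    Measure.addHaar_ball_of_pos volume x (by linarith), hV,
    ← ENNReal.sub_mul (fun _ _ => measure_closedBall_lt_top.ne), finrank_euclideanSpace, Fintype.card_fin,
    ← ENNReal.ofReal_sub _ (by apply pow_nonneg; linarith)]
  gcongr
  have h1 := one_add_mul_le_pow (show (-2:ℝ) ≤ - (4 * r / (t + r)) by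
    rw [neg_le_neg_iff, div_le_iff₀ (by linarith)]; linarith) n
  have e : 1 + - (4 * r / (t + r)) = (t - 3 * r) / (t + r) := by field_simp; ring
  rw [e, div_pow, le_div_iff₀ (by positivity)] at h1
  have h2 : (t + r) ^ n ≤ 2 ^ n * t ^ n := by rw [← mul_pow]; gcongr; linarith
  have h3 : 4 * r / (t + r) ≤ 4 * (r / t) := by
    rw [mul_div_assoc]; gcongr; linarith
  calc (t + r) ^ n - (t - 3 * r) ^ n ≤ n * (4 * r / (t + r)) * (t + r) ^ n := by linarith
    _ ≤ n * (4 * (r / t)) * (2 ^ n * t ^ n) := by gcongr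
    _ = _ := by ring

lemma annulus_int (n : ℕ) (g : EuclideanSpace ℝ (Fin n) → ℝ≥0∞) (hg : AEMeasurable g volume)
    (x z : EuclideanSpace ℝ (Fin n)) (t r : ℝ) (hr : 0 < r) (hrt : 8 * r ≤ t) (hxz : dist x z ≤ 2 * r)
    (B : ℝ)
    (H : ∀ w, dist w x ≤ t + r → ∫⁻ y in closedBall w r, g y ≤ ENNReal.ofReal B) :
    ∫⁻ y in closedBall x t \ closedBall z t, g y ≤ ENNReal.ofReal (4 * n * 2 ^ n * ((r / t) * (t / r) ^ n * B)) := by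
  have ht : 0 < t := by linarith
  set S := closedBall x t \ closedBall z t with hS
  have hSm : MeasurableSet S := measurableSet_closedBall.diff measurableSet_closedBall
  set V := volume (closedBall (0 : EuclideanSpace ℝ (Fin n)) 1) with hV
  set A' := closedBall x (t + r) \ ball x (t - 3 * r) with hA'
  have hA'm : MeasurableSet A' := measurableSet_closedBall.diff measurableSet_ball
  have hDm : MeasurableSet {p : EuclideanSpace ℝ (Fin n) × EuclideanSpace ℝ (Fin n) | dist p.1 p.2 ≤ r} :=
    (isClosed_le (by fun_prop) (by fun_prop)).measurableSet
  have key : (∫⁻ y in S, g y) * (ENNReal.ofReal (r ^ n) * V) ≤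
      ENNReal.ofReal (4 * n * 2 ^ n * (r / t) * t ^ n) * V * ENNReal.ofReal B := by
    calc (∫⁻ y in S, g y) * (ENNReal.ofReal (r ^ n) * V)
        = ∫⁻ y in S, ∫⁻ w, {p : EuclideanSpace ℝ (Fin n) × EuclideanSpace ℝ (Fin n) | dist p.1 p.2 ≤ r}.indicator (fun p => g p.1) (y, w) := by
          rw [← lintegral_mul_const'' _ hg.restrict]
          congr 1; ext y
          rw [← vol_cb n y r hr.le]
          have : ∀ w, {p : EuclideanSpace ℝ (Fin n) × EuclideanSpace ℝ (Fin n) | dist p.1 p.2 ≤ r}.indicator (fun p => g p.1) (y, w)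
            = (closedBall y r).indicator (fun _ => g y) w := by
            intro w
            simp [Set.indicator, dist_comm y w]
          simp_rw [this]
          rw [lintegral_indicator measurableSet_closedBall]
          simp
      _ = ∫⁻ w, ∫⁻ y in S, {p : EuclideanSpace ℝ (Fin n) × EuclideanSpace ℝ (Fin n) | dist p.1 p.2 ≤ r}.indicator (fun p => g p.1) (y, w) := by
          apply lintegral_lintegral_swap
          apply AEMeasurable.indicator _ hDm
          exact hg.restrict.comp_fst
      _ ≤ ∫⁻ w, A'.indicator (fun _ => ENNReal.ofReal B) w := by
          apply lintegral_mono
          intro w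
          dsimp only
          have e : ∀ y, {p : EuclideanSpace ℝ (Fin n) × EuclideanSpace ℝ (Fin n) | dist p.1 p.2 ≤ r}.indicator (fun p => g p.1) (y, w)
            = (closedBall w r).indicator g y := by
            intro y; simp [Set.indicator]
          simp_rw [e]
          rw [setLIntegral_indicator measurableSet_closedBall]
          by_cases hw : w ∈ A'
          · rw [Set.indicator_of_mem hw]
            refine (lintegral_mono_set Set.inter_subset_left).trans (H w ?_)
            exact hw.1
          · have : closedBall w r ∩ S = ∅ := by
              rw [Set.eq_empty_iff_forall_notMem]
              rintro y ⟨hy1, hy2, hy3⟩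
              apply hw
              rw [mem_closedBall] at hy1 hy2 hy3
              constructor
              · rw [mem_closedBall]
                linarith [dist_triangle w y x, dist_comm w y]
              · rw [mem_ball]
                linarith [dist_triangle y w x, dist_triangle y x z]
            simp [this]
      _ = volume A' * ENNReal.ofReal B := by
          rw [lintegral_indicator hA'm]; simp [mul_comm]
      _ ≤ _ := by
          gcongr
          exact vol_annulus n x t r hr hrt
  have hV0 : V ≠ 0 := (measure_closedBall_pos volume _ one_pos).ne'
  have hVt : V ≠ ⊤ := measure_closedBall_lt_top.ne
  have hr0 : ENNReal.ofReal (r ^ n) ≠ 0 := by simp; positivity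
  rw [← mul_assoc, mul_right_comm _ V, ENNReal.mul_le_mul_iff_left hV0 hVt, ← ENNReal.ofReal_mul (by positivity),
   ← ENNReal.le_div_iff_mul_le (Or.inl hr0) (Or.inl ENNReal.ofReal_ne_top), ← ENNReal.ofReal_div_of_pos (by positivity)] at key
  refine key.trans (le_of_eq ?_)
  congr 1
  rw [div_pow]
  field_simp


lemma norm_le_one_norm {n m : ℕ} (u : Fin m → EuclideanSpace ℝ (Fin n)) : ‖u‖ ≤ ∑ i, ‖u i‖ := by
  rw [pi_norm_le_iff_of_nonneg (by positivity)]
  intro i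
  exact Finset.single_le_sum (f := fun i => ‖u i‖) (fun i _ => norm_nonneg _) (Finset.mem_univ i)

lemma one_norm_pos {n m : ℕ} {u : Fin m → EuclideanSpace ℝ (Fin n)} (hu : u ≠ 0) : 0 < ∑ i, ‖u i‖ :=
  (norm_pos_iff.2 hu).trans_le (norm_le_one_norm u)

lemma one_norm_diff {n m : ℕ} (u u' : Fin m → EuclideanSpace ℝ (Fin n)) :
    |∑ i, ‖u i‖ - ∑ i, ‖u' i‖| ≤ ∑ i, ‖u i - u' i‖ := by
  rw [← Finset.sum_sub_distrib]
  refine (Finset.abs_sum_le_sum_abs _ _).trans ?_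
  gcongr with i
  exact abs_norm_sub_norm_le _ _

lemma normalized_diff {n m : ℕ} {u u' : Fin m → EuclideanSpace ℝ (Fin n)} (hu : u ≠ 0) (hu' : u' ≠ 0) :
    ‖(∑ i, ‖u i‖)⁻¹ • u - (∑ i, ‖u' i‖)⁻¹ • u'‖ ≤ 2 * (∑ i, ‖u i - u' i‖) / (∑ i, ‖u' i‖) := by
  have hs := one_norm_pos hu
  have hs' := one_norm_pos hu'
  have hd := one_norm_diff u u'
  have hn := norm_le_one_norm u
  have hn2 := norm_le_one_norm (u - u')
  simp only [Pi.sub_apply] at hn2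
  set s := ∑ i, ‖u i‖
  set s' := ∑ i, ‖u' i‖
  set H := ∑ i, ‖u i - u' i‖
  have e : s⁻¹ • u - s'⁻¹ • u' = s'⁻¹ • (u - u') + (s⁻¹ - s'⁻¹) • u := by
    rw [smul_sub, sub_smul]; abel
  have e2 : |s⁻¹ - s'⁻¹| = |s - s'| / (s * s') := by
    rw [inv_sub_inv hs.ne' hs'.ne', abs_div, abs_of_pos (mul_pos hs hs'), abs_sub_comm]
  rw [e]
  calc _ ≤ s'⁻¹ * ‖u - u'‖ + |s⁻¹ - s'⁻¹| * ‖u‖ := by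
        refine (norm_add_le _ _).trans (le_of_eq ?_)
        rw [norm_smul, norm_smul, Real.norm_eq_abs, Real.norm_eq_abs, abs_of_pos (inv_pos.2 hs')]
    _ ≤ s'⁻¹ * H + H / (s * s') * s := by
        rw [e2]; gcongr
    _ = _ := by field_simp; ring

lemma omega_diff {n m : ℕ} {Ω : (Fin m → EuclideanSpace ℝ (Fin n)) → ℝ}
    {β C₀ : ℝ} (hβ0 : 0 < β) (hβ1 : β < 1) (hC₀ : 0 < C₀)
    (hΩlip : ∀ ξ η : Fin m → EuclideanSpace ℝ (Fin n), ξ ≠ 0 → η ≠ 0 →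
      |Ω ξ - Ω η| ≤ C₀ * ‖(∑ i, ‖ξ i‖)⁻¹ • ξ - (∑ i, ‖η i‖)⁻¹ • η‖ ^ β)
    {u u' : Fin m → EuclideanSpace ℝ (Fin n)} (hu : u ≠ 0) (hu' : u' ≠ 0) :
    |Ω u - Ω u'| ≤ 2 * C₀ * (∑ i, ‖u i - u' i‖) ^ β * (∑ i, ‖u' i‖) ^ (-β) := by
  refine (hΩlip u u' hu hu').trans ?_
  have hs' := one_norm_pos hu'
  have h := normalized_diff hu hu'
  have hH : 0 ≤ ∑ i, ‖u i - u' i‖ := by positivity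
  have h2 : (2:ℝ) ^ β ≤ 2 := by
    calc (2:ℝ) ^ β ≤ 2 ^ (1:ℝ) := Real.rpow_le_rpow_of_exponent_le (by norm_num) hβ1.le
      _ = 2 := by norm_num
  calc _ ≤ C₀ * (2 * (∑ i, ‖u i - u' i‖) / (∑ i, ‖u' i‖)) ^ β := by gcongr
    _ = C₀ * (2 ^ β * (∑ i, ‖u i - u' i‖) ^ β * (∑ i, ‖u' i‖) ^ (-β)) := by
        rw [Real.div_rpow (by positivity) (by positivity), Real.mul_rpow (by norm_num) hH, Real.rpow_neg hs'.le]
        rfl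
    _ ≤ C₀ * (2 * (∑ i, ‖u i - u' i‖) ^ β * (∑ i, ‖u' i‖) ^ (-β)) := by gcongr
    _ = _ := by ring

lemma omega_bdd {n m : ℕ} {Ω : (Fin m → EuclideanSpace ℝ (Fin n)) → ℝ}
    {β C₀ : ℝ} (hβ0 : 0 < β) (hC₀ : 0 < C₀)
    (hΩlip : ∀ ξ η : Fin m → EuclideanSpace ℝ (Fin n), ξ ≠ 0 → η ≠ 0 →
      |Ω ξ - Ω η| ≤ C₀ * ‖(∑ i, ‖ξ i‖)⁻¹ • ξ - (∑ i, ‖η i‖)⁻¹ • η‖ ^ β) :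
    ∃ M > (0:ℝ), ∀ u, u ≠ 0 → |Ω u| ≤ M := by
  by_cases h : ∃ e : Fin m → EuclideanSpace ℝ (Fin n), e ≠ 0
  · obtain ⟨e, he⟩ := h
    refine ⟨|Ω e| + C₀ * 2 ^ β, by positivity, ?_⟩
    intro u hu
    have h1 := hΩlip u e hu he
    have hle : ∀ v : Fin m → EuclideanSpace ℝ (Fin n), v ≠ 0 → ‖(∑ i, ‖v i‖)⁻¹ • v‖ ≤ 1 := by
      intro v hv
      have := one_norm_pos hv
      rw [norm_smul, Real.norm_eq_abs, abs_of_pos (inv_pos.2 this), inv_mul_le_iff₀ this, mul_one]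
      exact norm_le_one_norm v
    have h2 : ‖(∑ i, ‖u i‖)⁻¹ • u - (∑ i, ‖e i‖)⁻¹ • e‖ ≤ 2 := by
      refine (norm_sub_le _ _).trans ?_
      linarith [hle u hu, hle e he]
    have h3 : |Ω u - Ω e| ≤ C₀ * 2 ^ β := h1.trans (by gcongr)
    have := abs_sub_abs_le_abs_sub (Ω u) (Ω e)
    linarith
  · push Not at h
    exact ⟨1, one_pos, fun u hu => absurd (h u) hu⟩

lemma pow_diff (p : ℕ) (β s s' H : ℝ) (hβ0 : 0 < β) (hβ1 : β < 1) (hs : 0 < s) (hss : s ≤ s') (hH : s' - s ≤ H) :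
    |(s ^ (p:ℝ))⁻¹ - (s' ^ (p:ℝ))⁻¹| ≤ p * H ^ β * s ^ (-(p + β)) := by
  have hs' : 0 < s' := by linarith
  have h1 := one_add_mul_le_pow (show (-2:ℝ) ≤ s / s' - 1 by linarith [div_pos hs hs']) p
  rw [add_sub_cancel] at h1
  have hq1 : s / s' ≤ 1 := by rw [div_le_one hs']; exact hss
  have e : 1 - s / s' = (s' - s) / s' := by field_simp
  have hq : 1 - s / s' ≤ H ^ β * s ^ (-β) := by
    calc 1 - s / s' ≤ (1 - s / s') ^ β := Real.self_le_rpow_of_le_one (by linarith) (by linarith [div_pos hs hs']) hβ1.le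
      _ ≤ (H / s) ^ β := by
        apply Real.rpow_le_rpow (by linarith) _ hβ0.le
        rw [e]
        apply div_le_div₀ _ hH hs hss
        linarith
      _ = _ := by rw [Real.div_rpow (by linarith) hs.le, Real.rpow_neg hs.le]; rfl
  rw [Real.rpow_natCast, Real.rpow_natCast]
  have e3 : (s ^ p)⁻¹ - (s' ^ p)⁻¹ = (s ^ p)⁻¹ * (1 - (s / s') ^ p) := by
    rw [div_pow]; field_simp
  have h4 : (s / s') ^ p ≤ 1 := pow_le_one₀ (by positivity) hq1
  rw [e3, abs_of_nonneg (mul_nonneg (by positivity) (by linarith))]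
  calc (s ^ p)⁻¹ * (1 - (s / s') ^ p) ≤ (s ^ p)⁻¹ * (p * (H ^ β * s ^ (-β))) := by
        gcongr
        calc 1 - (s / s') ^ p ≤ p * (1 - s / s') := by linarith
          _ ≤ _ := by gcongr
    _ = _ := by
        rw [neg_add, Real.rpow_add hs, Real.rpow_neg hs.le (p:ℝ), Real.rpow_natCast]; ring

lemma kernel_diff {n m : ℕ} {Ω : (Fin m → EuclideanSpace ℝ (Fin n)) → ℝ}
    {β C₀ M : ℝ} (hβ0 : 0 < β) (hβ1 : β < 1) (hC₀ : 0 < C₀) (hM : 0 < M)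
    (hΩlip : ∀ ξ η : Fin m → EuclideanSpace ℝ (Fin n), ξ ≠ 0 → η ≠ 0 →
      |Ω ξ - Ω η| ≤ C₀ * ‖(∑ i, ‖ξ i‖)⁻¹ • ξ - (∑ i, ‖η i‖)⁻¹ • η‖ ^ β)
    (hΩb : ∀ u, u ≠ 0 → |Ω u| ≤ M) (p : ℕ)
    (u u' : Fin m → EuclideanSpace ℝ (Fin n)) (hu : u ≠ 0) (hu' : u' ≠ 0) :
    |Ω u / (∑ i, ‖u i‖) ^ (p:ℝ) - Ω u' / (∑ i, ‖u' i‖) ^ (p:ℝ)| ≤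
      (2 * C₀ + p * M) * (∑ i, ‖u i - u' i‖) ^ β *
       ((∑ i, ‖u i‖) ^ (-(p + β)) + (∑ i, ‖u' i‖) ^ (-(p + β))) := by
  wlog hss : ∑ i, ‖u i‖ ≤ ∑ i, ‖u' i‖ generalizing u u' with W
  · have := W u' u hu' hu (le_of_not_ge hss)
    rw [abs_sub_comm, add_comm ((∑ i, ‖u i‖) ^ (-(p + β)))]
    simpa only [norm_sub_rev] using this
  have hs := one_norm_pos hu
  have hs' := one_norm_pos hu'
  have hd := one_norm_diff u u'
  have hΩ := omega_diff hβ0 hβ1 hC₀ hΩlip hu hu'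
  have hb := hΩb u hu
  set s := ∑ i, ‖u i‖
  set s' := ∑ i, ‖u' i‖
  have hH0 : 0 ≤ ∑ i, ‖u i - u' i‖ := by positivity
  set H := ∑ i, ‖u i - u' i‖
  have hpd := pow_diff p β s s' H hβ0 hβ1 hs hss (by rw [abs_sub_comm] at hd; exact (le_abs_self _).trans hd)
  have e : Ω u / s ^ (p:ℝ) - Ω u' / s' ^ (p:ℝ) = (Ω u - Ω u') * (s' ^ (p:ℝ))⁻¹ + Ω u * ((s ^ (p:ℝ))⁻¹ - (s' ^ (p:ℝ))⁻¹) := by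
    ring
  rw [e]
  calc _ ≤ |Ω u - Ω u'| * (s' ^ (p:ℝ))⁻¹ + |Ω u| * |(s ^ (p:ℝ))⁻¹ - (s' ^ (p:ℝ))⁻¹| := by
        refine (abs_add_le _ _).trans (le_of_eq ?_)
        rw [abs_mul, abs_mul, abs_of_pos (show 0 < (s' ^ (p:ℝ))⁻¹ by positivity)]
    _ ≤ (2 * C₀ * H ^ β * s' ^ (-β)) * (s' ^ (p:ℝ))⁻¹ + M * (p * H ^ β * s ^ (-(p + β))) := by gcongr
    _ = 2 * C₀ * H ^ β * s' ^ (-(p + β)) + p * M * H ^ β * s ^ (-(p + β)) := by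
        rw [← Real.rpow_neg hs'.le, neg_add, Real.rpow_add hs' (-(p:ℝ))]; ring
    _ ≤ 2 * C₀ * H ^ β * (s ^ (-(p + β)) + s' ^ (-(p + β))) + p * M * H ^ β * (s ^ (-(p + β)) + s' ^ (-(p + β))) := by
        gcongr
        · have : 0 < s ^ (-(p + β)) := by positivity
          linarith
        · have : 0 < s' ^ (-(p + β)) := by positivity
          linarith
    _ = _ := by ring

/-- product domination of the kernel singularity -/
lemma one_norm_rpow_le {n m : ℕ} (b : ℝ) (hb : 0 ≤ b) (u : Fin m → EuclideanSpace ℝ (Fin n))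
    (hu : ∀ i, u i ≠ 0) : (∑ i, ‖u i‖) ^ (-(m * b)) ≤ ∏ i, ‖u i‖ ^ (-b) := by
  have h0 : ∀ i, 0 < ‖u i‖ := fun i => norm_pos_iff.2 (hu i)
  have hs : 0 ≤ ∑ i, ‖u i‖ := by positivity
  calc (∑ i, ‖u i‖) ^ (-(m * b)) = ∏ _i : Fin m, (∑ i, ‖u i‖) ^ (-b) := by
        rw [Finset.prod_const, Finset.card_univ, Fintype.card_fin, ← Real.rpow_natCast, ← Real.rpow_mul hs]
        congr 1; ring
    _ ≤ _ := by
        apply Finset.prod_le_prod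
        · intros; positivity
        · intro i _
          apply Real.rpow_le_rpow_of_nonpos (h0 i) _ (by linarith)
          exact Finset.single_le_sum (f := fun i => ‖u i‖) (fun i _ => norm_nonneg _) (Finset.mem_univ i)


lemma lintegral_pi_prod (n : ℕ) : ∀ (m : ℕ) (g : Fin m → EuclideanSpace ℝ (Fin n) → ℝ≥0∞),
    (∀ i, AEMeasurable (g i) volume) →
    ∫⁻ y : Fin m → EuclideanSpace ℝ (Fin n), ∏ i, g i (y i) = ∏ i, ∫⁻ y, g i y := by
  intro m
  induction m with
  | zero => intro g _; simp [volume_pi]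
  | succ m ih =>
    intro g hg
    have hmp := (volume_preserving_piFinSuccAbove (fun _ : Fin (m + 1) => EuclideanSpace ℝ (Fin n)) 0).symm
    rw [← hmp.lintegral_comp_emb (MeasurableEquiv.measurableEmbedding _)]
    simp only [MeasurableEquiv.piFinSuccAbove_symm_apply, Fin.insertNthEquiv, Equiv.coe_fn_mk, Fin.insertNth_zero,
      Fin.prod_univ_succ, Fin.cons_zero, Fin.cons_succ]
    rw [← ih (fun i => g i.succ) (fun i => hg _)]
    refine lintegral_prod_mul (μ := volume) (ν := volume) (f := g 0) (g := fun y : Fin m → EuclideanSpace ℝ (Fin n) => ∏ i, g i.succ (y i)) (hg 0) ?_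
    refine Finset.aemeasurable_fun_prod _ fun i _ => ?_
    exact (hg _).comp_quasiMeasurePreserving (Measure.quasiMeasurePreserving_eval _ i)

lemma sphere_zero (n : ℕ) (hn : 1 ≤ n) (φ : EuclideanSpace ℝ (Fin n) → ℝ)
    (H : ∀ ρ : ℝ, 0 < ρ → ∫ z : sphere (0 : EuclideanSpace ℝ (Fin n)) 1, φ (ρ • (z : EuclideanSpace ℝ (Fin n)))
      ∂(volume : Measure (EuclideanSpace ℝ (Fin n))).toSphere = 0) : ∫ v, φ v = 0 := by
  have : Nonempty (Fin n) := ⟨⟨0, hn⟩⟩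
  have h1 : ∫ v, φ v = ∫ v : ({0}ᶜ : Set (EuclideanSpace ℝ (Fin n))), φ v ∂(volume.comap Subtype.val) := by
    rw [integral_subtype_comap (measurableSet_singleton _).compl, restrict_compl_singleton]
  rw [h1]
  have hmp := (volume : Measure (EuclideanSpace ℝ (Fin n))).measurePreserving_homeomorphUnitSphereProd
  have h2 : ∀ v : ({0}ᶜ : Set (EuclideanSpace ℝ (Fin n))), φ v =
     (fun p : sphere (0 : EuclideanSpace ℝ (Fin n)) 1 × Set.Ioi (0:ℝ) => φ (p.2.1 • (p.1 : EuclideanSpace ℝ (Fin n))))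
       (homeomorphUnitSphereProd _ v) := by
    intro v
    simp only [homeomorphUnitSphereProd_apply_snd_coe, homeomorphUnitSphereProd_apply_fst_coe]
    rw [smul_smul, mul_inv_cancel₀ (norm_ne_zero_iff.2 v.2), one_smul]
  rw [integral_congr_ae (Filter.Eventually.of_forall h2)]
  refine (hmp.integral_comp (Homeomorph.measurableEmbedding _) (fun p : sphere (0 : EuclideanSpace ℝ (Fin n)) 1 × Set.Ioi (0:ℝ) =>
    φ (p.2.1 • (p.1 : EuclideanSpace ℝ (Fin n))))).trans ?_
  by_cases hi : Integrable (fun p : sphere (0 : EuclideanSpace ℝ (Fin n)) 1 × Set.Ioi (0:ℝ) => φ (p.2.1 • (p.1 : EuclideanSpace ℝ (Fin n))))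
    ((volume : Measure (EuclideanSpace ℝ (Fin n))).toSphere.prod (Measure.volumeIoiPow (Module.finrank ℝ (EuclideanSpace ℝ (Fin n)) - 1)))
  · rw [integral_prod_symm _ hi]
    have : ∀ ρ : Set.Ioi (0:ℝ), ∫ z : sphere (0 : EuclideanSpace ℝ (Fin n)) 1, φ (ρ.1 • (z : EuclideanSpace ℝ (Fin n)))
      ∂(volume : Measure (EuclideanSpace ℝ (Fin n))).toSphere = 0 := fun ρ => H ρ.1 ρ.2
    simp_rw [this]
    simp
  · rw [integral_undef hi]

lemma vanish_succ (n m : ℕ) (hn : 1 ≤ n)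
    (Ω : (Fin (m + 1) → EuclideanSpace ℝ (Fin n)) → ℝ)
    (hΩhom : ∀ l : ℝ, 0 < l → ∀ y : Fin (m + 1) → EuclideanSpace ℝ (Fin n), Ω (l • y) = Ω y)
    (hΩvan : ∀ (j : Fin (m + 1)) (y : Fin (m + 1) → EuclideanSpace ℝ (Fin n)),
      ∫ z : sphere (0 : EuclideanSpace ℝ (Fin n)) 1,
        Ω (Function.update y j (z : EuclideanSpace ℝ (Fin n)))
        ∂(volume : Measure (EuclideanSpace ℝ (Fin n))).toSphere = 0)
    (p t : ℝ) (x : EuclideanSpace ℝ (Fin n)) (h : Fin (m + 1) → EuclideanSpace ℝ (Fin n) → ℝ)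
    (j : Fin (m + 1)) (c : ℝ) (hj : ∀ y, h j y = c) :
    ∫ y in Set.univ.pi fun _ : Fin (m + 1) => closedBall (0 : EuclideanSpace ℝ (Fin n)) t,
      Ω y / (∑ j, ‖y j‖) ^ p * ∏ i, h i (x - y i) = 0 := by
  rw [← integral_indicator (MeasurableSet.univ_pi fun _ => measurableSet_closedBall)]
  set G := (Set.univ.pi fun _ : Fin (m + 1) => closedBall (0 : EuclideanSpace ℝ (Fin n)) t).indicator
    fun y => Ω y / (∑ j, ‖y j‖) ^ p * ∏ i, h i (x - y i) with hG
  have hmp := (volume_preserving_piFinSuccAbove (fun _ : Fin (m + 1) => EuclideanSpace ℝ (Fin n)) j).symm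
  rw [← hmp.integral_comp (MeasurableEquiv.measurableEmbedding _)]
  simp only [MeasurableEquiv.piFinSuccAbove_symm_apply, Fin.insertNthEquiv, Equiv.coe_fn_mk]
  by_cases hi : Integrable (fun q : EuclideanSpace ℝ (Fin n) × (Fin m → EuclideanSpace ℝ (Fin n)) => G (j.insertNth q.1 q.2))
     (volume.prod volume)
  · rw [Measure.volume_eq_prod, integral_prod_symm _ hi]
    have : ∀ y' : Fin m → EuclideanSpace ℝ (Fin n), ∫ v, G (j.insertNth v y') = 0 := by
      intro y'
      apply sphere_zero n hn
      intro ρ hρ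
      have key : ∀ z : sphere (0 : EuclideanSpace ℝ (Fin n)) 1, G (j.insertNth (ρ • (z : EuclideanSpace ℝ (Fin n))) y') =
        (if ρ ≤ t ∧ ∀ i, ‖y' i‖ ≤ t then (((ρ + ∑ i, ‖y' i‖) ^ p)⁻¹ * (c * ∏ i, h (j.succAbove i) (x - y' i))) else 0) *
         Ω (Function.update (j.insertNth 0 (ρ⁻¹ • y')) j (z : EuclideanSpace ℝ (Fin n))) := by
        intro z
        have hz : ‖(z : EuclideanSpace ℝ (Fin n))‖ = 1 := by simp
        have e1 : Ω (Function.update (j.insertNth 0 (ρ⁻¹ • y')) j (z : EuclideanSpace ℝ (Fin n))) =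
          Ω (j.insertNth (ρ • (z : EuclideanSpace ℝ (Fin n))) y') := by
          rw [Fin.update_insertNth, ← hΩhom ρ hρ]
          congr 1
          ext1 i
          rcases Fin.eq_self_or_eq_succAbove j i with rfl | ⟨k, rfl⟩
          · simp
          · simp [smul_smul, hρ.ne']
        have hmem : (j.insertNth (ρ • (z : EuclideanSpace ℝ (Fin n))) y' : Fin (m + 1) → EuclideanSpace ℝ (Fin n)) ∈
            (Set.univ.pi fun _ : Fin (m + 1) => closedBall (0 : EuclideanSpace ℝ (Fin n)) t) ↔ ρ ≤ t ∧ ∀ i, ‖y' i‖ ≤ t := by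
          simp only [Set.mem_univ_pi, mem_closedBall_zero_iff]
          rw [j.forall_iff_succAbove]
          simp [norm_smul, abs_of_pos hρ]
        rw [hG, e1]
        by_cases hc : ρ ≤ t ∧ ∀ i, ‖y' i‖ ≤ t
        · rw [Set.indicator_of_mem (hmem.2 hc), if_pos hc]
          simp only [Fin.sum_univ_succAbove _ j, Fin.prod_univ_succAbove _ j, Fin.insertNth_apply_same,
            Fin.insertNth_apply_succAbove, hj, norm_smul, hz, mul_one, Real.norm_eq_abs, abs_of_pos hρ]
          ring
        · rw [Set.indicator_of_notMem (fun h => hc (hmem.1 h)), if_neg hc, zero_mul]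
      simp_rw [key]
      rw [integral_const_mul, hΩvan, mul_zero]
    simp_rw [this]
    simp
  · exact integral_undef hi


lemma omega_meas {n m : ℕ} {Ω : (Fin m → EuclideanSpace ℝ (Fin n)) → ℝ}
    {β C₀ : ℝ} (hβ0 : 0 < β)
    (hΩlip : ∀ ξ η : Fin m → EuclideanSpace ℝ (Fin n), ξ ≠ 0 → η ≠ 0 →
      |Ω ξ - Ω η| ≤ C₀ * ‖(∑ i, ‖ξ i‖)⁻¹ • ξ - (∑ i, ‖η i‖)⁻¹ • η‖ ^ β) : Measurable Ω := by
  apply measurable_of_continuousOn_compl_singleton 0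
  intro η hη
  have hη0 : η ≠ 0 := hη
  apply ContinuousAt.continuousWithinAt
  rw [ContinuousAt, tendsto_iff_dist_tendsto_zero]
  have hc : ContinuousAt (fun ξ : Fin m → EuclideanSpace ℝ (Fin n) => C₀ * ‖(∑ i, ‖ξ i‖)⁻¹ • ξ - (∑ i, ‖η i‖)⁻¹ • η‖ ^ β) η := by
    apply ContinuousAt.mul continuousAt_const
    apply ContinuousAt.rpow_const _ (Or.inr hβ0.le)
    apply ContinuousAt.norm
    apply ContinuousAt.sub _ continuousAt_const
    apply ContinuousAt.fun_smul _ continuousAt_id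
    have hcc : ContinuousAt (fun ξ : Fin m → EuclideanSpace ℝ (Fin n) => ∑ i, ‖ξ i‖) η := by
      apply Continuous.continuousAt
      fun_prop
    exact hcc.inv₀ (one_norm_pos hη0).ne'
  have h0 : C₀ * ‖(∑ i, ‖η i‖)⁻¹ • η - (∑ i, ‖η i‖)⁻¹ • η‖ ^ β = 0 := by simp [Real.zero_rpow hβ0.ne']
  rw [ContinuousAt, h0] at hc
  apply squeeze_zero' (Filter.Eventually.of_forall fun _ => dist_nonneg) _ hc
  filter_upwards [isOpen_ne.mem_nhds hη0] with ξ hξ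
  exact hΩlip ξ η hξ hη0

lemma vol_neg_inv (n m : ℕ) : (volume : Measure (Fin m → EuclideanSpace ℝ (Fin n))).IsNegInvariant := by
  have : (volume : Measure (EuclideanSpace ℝ (Fin n))).IsNegInvariant := by infer_instance
  exact Measure.pi.isNegInvariant _

lemma enorm_fin_prod {m : ℕ} (a : Fin m → ℝ) : ‖∏ i, a i‖ₑ = ∏ i, ‖a i‖ₑ := by
  rw [← ofReal_norm, norm_prod, ENNReal.ofReal_prod_of_nonneg (fun i _ => norm_nonneg _)]
  simp_rw [ofReal_norm]

/-- truncated kernel -/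
noncomputable def ker0 (n m : ℕ) (Ω : (Fin m → EuclideanSpace ℝ (Fin n)) → ℝ) (t : ℝ)
    (u : Fin m → EuclideanSpace ℝ (Fin n)) : ℝ :=
  (Set.univ.pi fun _ : Fin m => closedBall (0 : EuclideanSpace ℝ (Fin n)) t).indicator
    (fun y => Ω y / (∑ j, ‖y j‖) ^ ((m : ℝ) * ((n : ℝ) - 1))) u

/-- one-variable truncated singular weight -/
noncomputable def QQ (n : ℕ) (t b : ℝ) (x y : EuclideanSpace ℝ (Fin n)) : ℝ≥0∞ :=
  (closedBall x t).indicator (fun y => ENNReal.ofReal (‖x - y‖ ^ (-b))) y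

lemma QQ_meas (n : ℕ) (t b : ℝ) (x : EuclideanSpace ℝ (Fin n)) : Measurable (QQ n t b x) := by
  unfold QQ
  apply Measurable.indicator _ measurableSet_closedBall
  fun_prop

lemma ker0_meas {n m : ℕ} {Ω : (Fin m → EuclideanSpace ℝ (Fin n)) → ℝ} (hΩ : Measurable Ω) (t : ℝ) :
    Measurable (ker0 n m Ω t) := by
  unfold ker0
  apply Measurable.indicator _ (MeasurableSet.univ_pi fun _ => measurableSet_closedBall)
  fun_prop

lemma mFt_eq (n m : ℕ) (Ω : (Fin m → EuclideanSpace ℝ (Fin n)) → ℝ)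
    (f : Fin m → EuclideanSpace ℝ (Fin n) → ℝ) (t : ℝ) (x : EuclideanSpace ℝ (Fin n)) :
    mFt n m Ω f t x = t ^ (-(m : ℝ)) * ∫ w : Fin m → EuclideanSpace ℝ (Fin n),
      ker0 n m Ω t ((fun _ => x) - w) * ∏ i, f i (w i) := by
  unfold mFt
  have := vol_neg_inv n m
  congr 1
  rw [← integral_sub_left_eq_self _ volume (fun _ => x : Fin m → EuclideanSpace ℝ (Fin n)),
    ← integral_indicator (MeasurableSet.univ_pi fun _ => measurableSet_closedBall)]
  congr 1
  ext y
  have hsub : (fun _ => x) - ((fun _ => x) - y) = y := sub_sub_cancel _ _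
  rw [hsub]
  unfold ker0
  simp only [Pi.sub_apply, Set.indicator]
  split_ifs <;> simp

lemma mem_P_iff {n m : ℕ} (t : ℝ) (x : EuclideanSpace ℝ (Fin n)) (w : Fin m → EuclideanSpace ℝ (Fin n)) :
    ((fun _ => x) - w) ∈ (Set.univ.pi fun _ : Fin m => closedBall (0 : EuclideanSpace ℝ (Fin n)) t) ↔
    ∀ i, w i ∈ closedBall x t := by
  simp [dist_eq_norm, norm_sub_rev]

lemma prod_QQ {n m : ℕ} (t b : ℝ) (x : EuclideanSpace ℝ (Fin n)) (w : Fin m → EuclideanSpace ℝ (Fin n))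
    (h : ∀ i, w i ∈ closedBall x t) :
    ∏ i, QQ n t b x (w i) = ENNReal.ofReal (∏ i, ‖x - w i‖ ^ (-b)) := by
  rw [ENNReal.ofReal_prod_of_nonneg (fun i _ => by positivity)]
  apply Finset.prod_congr rfl
  intro i _
  rw [QQ, Set.indicator_of_mem (h i)]

lemma u_ne {n m : ℕ} (hm : 1 ≤ m) (x : EuclideanSpace ℝ (Fin n)) (w : Fin m → EuclideanSpace ℝ (Fin n))
    (h : ∀ i, w i ≠ x) : ((fun _ => x) - w : Fin m → EuclideanSpace ℝ (Fin n)) ≠ 0 := by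
  intro h0
  have := congrFun h0 ⟨0, hm⟩
  simp only [Pi.sub_apply, Pi.zero_apply, sub_eq_zero] at this
  exact h _ this.symm

lemma ker0_bound {n m : ℕ} (hn : 1 ≤ n) (hm : 1 ≤ m) {Ω : (Fin m → EuclideanSpace ℝ (Fin n)) → ℝ} {M : ℝ}
    (hM : 0 < M) (hΩb : ∀ u, u ≠ 0 → |Ω u| ≤ M) (t : ℝ) (x : EuclideanSpace ℝ (Fin n))
    (w : Fin m → EuclideanSpace ℝ (Fin n)) (hw : ∀ i, w i ≠ x) :
    ‖ker0 n m Ω t ((fun _ => x) - w)‖ₑ ≤ ENNReal.ofReal M * ∏ i, QQ n t (n - 1) x (w i) := by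
  unfold ker0
  by_cases h : ∀ i, w i ∈ closedBall x t
  · rw [Set.indicator_of_mem ((mem_P_iff t x w).2 h), prod_QQ t _ x w h, ← ENNReal.ofReal_mul hM.le,
      ← ofReal_norm]
    apply ENNReal.ofReal_le_ofReal
    have hu := u_ne hm x w hw
    have hs := one_norm_pos hu
    have h1 := one_norm_rpow_le ((n:ℝ) - 1) (by have : (1:ℝ) ≤ n := by exact_mod_cast hn
                                                linarith) ((fun _ => x) - w)
      (fun i => by simpa [sub_eq_zero] using (hw i).symm)
    rw [norm_div, Real.norm_eq_abs, Real.norm_eq_abs, abs_of_nonneg (Real.rpow_nonneg hs.le _), div_eq_mul_inv, ← Real.rpow_neg hs.le]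
    gcongr
    · exact hΩb _ hu
    · exact h1
  · rw [Set.indicator_of_notMem (fun h' => h ((mem_P_iff t x w).1 h'))]
    simp

lemma ae_ne {n m : ℕ} (hn : 1 ≤ n) (x : EuclideanSpace ℝ (Fin n)) :
    ∀ᵐ w : Fin m → EuclideanSpace ℝ (Fin n), ∀ i, w i ≠ x := by
  have : Nonempty (Fin n) := ⟨⟨0, hn⟩⟩
  rw [ae_all_iff]
  intro i
  have h : ∀ᵐ y : EuclideanSpace ℝ (Fin n), y ≠ x := by
    rw [ae_iff]; simp
  exact (Measure.quasiMeasurePreserving_eval (fun _ : Fin m => (volume : Measure (EuclideanSpace ℝ (Fin n)))) i).ae h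

lemma prod_aesm {n m : ℕ} {h : Fin m → EuclideanSpace ℝ (Fin n) → ℝ} (hh : ∀ i, AEStronglyMeasurable (h i) volume) :
    AEStronglyMeasurable (fun w : Fin m → EuclideanSpace ℝ (Fin n) => ∏ i, h i (w i)) volume := by
  refine Finset.aestronglyMeasurable_fun_prod _ fun i _ => ?_
  exact (hh _).comp_quasiMeasurePreserving (Measure.quasiMeasurePreserving_eval _ i)

lemma ker0_integrable {n m : ℕ} (hn : 1 ≤ n) (hm : 1 ≤ m) {Ω : (Fin m → EuclideanSpace ℝ (Fin n)) → ℝ}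
    (hΩ : Measurable Ω) {M : ℝ}
    (hM : 0 < M) (hΩb : ∀ u, u ≠ 0 → |Ω u| ≤ M) (t : ℝ) (x : EuclideanSpace ℝ (Fin n))
    (h : Fin m → EuclideanSpace ℝ (Fin n) → ℝ) (hh : ∀ i, AEStronglyMeasurable (h i) volume)
    (hJ : ∀ i, ∫⁻ y, QQ n t (n - 1) x y * ‖h i y‖ₑ < ⊤) :
    Integrable (fun w : Fin m → EuclideanSpace ℝ (Fin n) => ker0 n m Ω t ((fun _ => x) - w) * ∏ i, h i (w i)) volume := by
  refine ⟨?_, ?_⟩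
  · apply AEStronglyMeasurable.mul _ (prod_aesm hh)
    exact ((ker0_meas hΩ t).comp (by fun_prop : Measurable fun w : Fin m → EuclideanSpace ℝ (Fin n) => (fun _ => x) - w)).aestronglyMeasurable
  · rw [hasFiniteIntegral_iff_enorm]
    calc _ ≤ ∫⁻ w : Fin m → EuclideanSpace ℝ (Fin n), ENNReal.ofReal M * ∏ i, (QQ n t (n - 1) x (w i) * ‖h i (w i)‖ₑ) := by
          apply lintegral_mono_ae
          filter_upwards [ae_ne hn x] with w hw
          rw [enorm_mul, Finset.prod_mul_distrib, ← mul_assoc, enorm_fin_prod]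
          gcongr
          exact ker0_bound hn hm hM hΩb t x w hw
      _ = ENNReal.ofReal M * ∏ i, ∫⁻ y, QQ n t (n - 1) x y * ‖h i y‖ₑ := by
          rw [lintegral_const_mul' _ _ ENNReal.ofReal_ne_top,
            lintegral_pi_prod n m (fun i y => QQ n t (n - 1) x y * ‖h i y‖ₑ)]
          intro i
          exact (QQ_meas n t _ x).aemeasurable.mul (hh i).enorm
      _ < ⊤ := ENNReal.mul_lt_top ENNReal.ofReal_lt_top (ENNReal.prod_lt_top fun i _ => hJ i)

/-- subtracting constants does not change the operator -/
lemma mFt_sub_const {n m : ℕ} (hn : 1 ≤ n) (hm : 1 ≤ m) {Ω : (Fin m → EuclideanSpace ℝ (Fin n)) → ℝ}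
    (hΩ : Measurable Ω) {M : ℝ}
    (hM : 0 < M) (hΩb : ∀ u, u ≠ 0 → |Ω u| ≤ M)
    (hΩhom : ∀ l : ℝ, 0 < l → ∀ y : Fin m → EuclideanSpace ℝ (Fin n), Ω (l • y) = Ω y)
    (hΩvan : ∀ (j : Fin m) (y : Fin m → EuclideanSpace ℝ (Fin n)),
      ∫ z : sphere (0 : EuclideanSpace ℝ (Fin n)) 1,
        Ω (Function.update y j (z : EuclideanSpace ℝ (Fin n)))
        ∂(volume : Measure (EuclideanSpace ℝ (Fin n))).toSphere = 0)
    (t : ℝ) (x : EuclideanSpace ℝ (Fin n))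
    (g : Fin m → EuclideanSpace ℝ (Fin n) → ℝ) (hg : ∀ i, AEStronglyMeasurable (g i) volume)
    (hJ : ∀ i, ∫⁻ y, QQ n t (n - 1) x y * ‖g i y‖ₑ < ⊤)
    (hJ1 : ∫⁻ y, QQ n t (n - 1) x y < ⊤) (c : Fin m → ℝ) :
    mFt n m Ω (fun i y => g i y + c i) t x = mFt n m Ω g t x := by
  rw [mFt_eq, mFt_eq]
  congr 1
  have e : ∀ w : Fin m → EuclideanSpace ℝ (Fin n), ker0 n m Ω t ((fun _ => x) - w) * ∏ i, (g i (w i) + c i) =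
    ∑ S ∈ (Finset.univ : Finset (Fin m)).powerset, ker0 n m Ω t ((fun _ => x) - w) *
      ∏ i, (if i ∈ S then g i else fun _ => c i) (w i) := by
    intro w
    rw [Finset.prod_add, Finset.mul_sum]
    apply Finset.sum_congr rfl
    intro S _
    congr 1
    rw [← Finset.prod_sdiff (Finset.subset_univ S), mul_comm]
    congr 1
    · apply Finset.prod_congr rfl
      intro i hi
      simp only [Finset.mem_sdiff] at hi
      simp [hi.2]
    · apply Finset.prod_congr rfl
      intro i hi
      simp [hi]
  simp_rw [e]
  rw [integral_finsetSum]
  · rw [Finset.sum_eq_single Finset.univ]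
    · simp
    · intro S _ hS
      obtain ⟨j, hj⟩ : ∃ j, j ∉ S := by
        by_contra hcon
        push Not at hcon
        exact hS (Finset.eq_univ_iff_forall.2 hcon)
      obtain ⟨m, rfl⟩ : ∃ k, m = k + 1 := ⟨m - 1, by omega⟩
      have hv := vanish_succ n m hn Ω hΩhom hΩvan (((m + 1 : ℕ) : ℝ) * ((n:ℝ) - 1)) t x (fun i => if i ∈ S then g i else fun _ => c i) j (c j)
        (fun y => by simp [hj])
      have := vol_neg_inv n (m + 1)
      rw [← integral_indicator (MeasurableSet.univ_pi fun _ => measurableSet_closedBall)] at hv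
      rw [← hv, ← integral_sub_left_eq_self _ volume (fun _ => x : Fin (m + 1) → EuclideanSpace ℝ (Fin n))]
      congr 1
      ext y
      have hsub : (fun _ => x) - ((fun _ => x) - y) = y := sub_sub_cancel _ _
      rw [hsub]
      unfold ker0
      simp only [Pi.sub_apply, Set.indicator]
      split_ifs <;> simp
    · simp
  · intro S _
    apply ker0_integrable hn hm hΩ hM hΩb t x (fun i => if i ∈ S then g i else fun _ => c i)
    · intro i
      split_ifs
      · exact hg i
      · exact aestronglyMeasurable_const
    · intro i
      split_ifs
      · exact hJ i
      · rw [lintegral_mul_const' _ _ (by simp)]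
        exact ENNReal.mul_lt_top hJ1 (by simp)


/-- weight restricted to the annular region -/
noncomputable def AN (n : ℕ) (t : ℝ) (x z y : EuclideanSpace ℝ (Fin n)) : ℝ≥0∞ :=
  (closedBall z t)ᶜ.indicator (QQ n t (n - 1) x) y

lemma AN_meas (n : ℕ) (t : ℝ) (x z : EuclideanSpace ℝ (Fin n)) : Measurable (AN n t x z) := by
  unfold AN
  exact (QQ_meas n t _ x).indicator measurableSet_closedBall.compl

/-- sum of the annular products -/
noncomputable def SA (n m : ℕ) (t : ℝ) (x z : EuclideanSpace ℝ (Fin n))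
    (w : Fin m → EuclideanSpace ℝ (Fin n)) : ℝ≥0∞ :=
  ∑ j, ∏ i, (if i = j then AN n t x z else QQ n t (n - 1) x) (w i)

lemma prod_le_SA {n m : ℕ} (t : ℝ) (x z : EuclideanSpace ℝ (Fin n))
    (w : Fin m → EuclideanSpace ℝ (Fin n)) (h : ¬ ∀ i, w i ∈ closedBall z t) :
    ∏ i, QQ n t (n - 1) x (w i) ≤ SA n m t x z w := by
  push Not at h
  obtain ⟨j, hj⟩ := h
  unfold SA
  refine le_trans (le_of_eq ?_) (Finset.single_le_sum (f := fun j => ∏ i, (if i = j then AN n t x z else QQ n t (n - 1) x) (w i)) (fun _ _ => zero_le) (Finset.mem_univ j))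
  apply Finset.prod_congr rfl
  intro i _
  by_cases hij : i = j
  · subst hij
    simp only [if_true]
    rw [AN, Set.indicator_of_mem hj]
  · simp [hij]

lemma ker0_diff {n m : ℕ} (hn : 1 ≤ n) (hm : 1 ≤ m) {Ω : (Fin m → EuclideanSpace ℝ (Fin n)) → ℝ} {M β C₀ : ℝ}
    (hβ0 : 0 < β) (hβ1 : β < 1) (hC₀ : 0 < C₀)
    (hM : 0 < M) (hΩb : ∀ u, u ≠ 0 → |Ω u| ≤ M)
    (hΩlip : ∀ ξ η : Fin m → EuclideanSpace ℝ (Fin n), ξ ≠ 0 → η ≠ 0 →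
      |Ω ξ - Ω η| ≤ C₀ * ‖(∑ i, ‖ξ i‖)⁻¹ • ξ - (∑ i, ‖η i‖)⁻¹ • η‖ ^ β)
    (t : ℝ) (x z : EuclideanSpace ℝ (Fin n))
    (w : Fin m → EuclideanSpace ℝ (Fin n)) (hx : ∀ i, w i ≠ x) (hz : ∀ i, w i ≠ z) :
    ‖ker0 n m Ω t ((fun _ => x) - w) - ker0 n m Ω t ((fun _ => z) - w)‖ₑ ≤
      ENNReal.ofReal ((2 * C₀ + (m * (n - 1) : ℕ) * M) * (m * ‖x - z‖) ^ β) *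
        (∏ i, QQ n t (n - 1 + β / m) x (w i) + ∏ i, QQ n t (n - 1 + β / m) z (w i)) +
      ENNReal.ofReal M * (SA n m t x z w + SA n m t z x w) := by
  by_cases h1 : ∀ i, w i ∈ closedBall x t
  · by_cases h2 : ∀ i, w i ∈ closedBall z t
    · refine le_trans ?_ le_self_add
      unfold ker0
      rw [Set.indicator_of_mem ((mem_P_iff t x w).2 h1), Set.indicator_of_mem ((mem_P_iff t z w).2 h2),
        prod_QQ t _ x w h1, prod_QQ t _ z w h2, ← ENNReal.ofReal_add (by positivity) (by positivity),
        ← ENNReal.ofReal_mul (by positivity), ← ofReal_norm]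
      apply ENNReal.ofReal_le_ofReal
      have hu := u_ne hm x w hx
      have hu' := u_ne hm z w hz
      have hk := kernel_diff hβ0 hβ1 hC₀ hM hΩlip hΩb (m * (n - 1)) _ _ hu hu'
      have hp : ((m * (n - 1) : ℕ) : ℝ) = (m : ℝ) * ((n : ℝ) - 1) := by
        push_cast [Nat.cast_sub hn]; ring
      have hm0 : (m : ℝ) ≠ 0 := by positivity
      have hn1 : (1 : ℝ) ≤ n := by exact_mod_cast hn
      have hb : ((m * (n - 1) : ℕ) : ℝ) + β = m * ((n : ℝ) - 1 + β / m) := by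
        rw [hp]; field_simp
      have hb0 : 0 ≤ (n : ℝ) - 1 + β / m := by
        have : 0 ≤ β / m := by positivity
        linarith
      have e1 : ∑ i : Fin m, ‖((fun _ => x) - w : Fin m → EuclideanSpace ℝ (Fin n)) i - ((fun _ => z) - w : Fin m → EuclideanSpace ℝ (Fin n)) i‖ = m * ‖x - z‖ := by
        simp
      rw [e1, hb] at hk
      rw [← hp]
      refine hk.trans ?_
      have hq1 := one_norm_rpow_le _ hb0 ((fun _ => x) - w) (fun i => by simpa [sub_eq_zero] using (hx i).symm)
      have hq2 := one_norm_rpow_le _ hb0 ((fun _ => z) - w) (fun i => by simpa [sub_eq_zero] using (hz i).symm)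
      gcongr
      · exact hq1
      · exact hq2
    · refine le_trans ?_ le_add_self
      have e : ker0 n m Ω t ((fun _ => z) - w) = 0 := by
        unfold ker0
        rw [Set.indicator_of_notMem (fun h' => h2 ((mem_P_iff t z w).1 h'))]
      rw [e, sub_zero]
      refine (ker0_bound hn hm hM hΩb t x w hx).trans ?_
      gcongr
      exact (prod_le_SA t x z w h2).trans le_self_add
  · have e : ker0 n m Ω t ((fun _ => x) - w) = 0 := by
      unfold ker0
      rw [Set.indicator_of_notMem (fun h' => h1 ((mem_P_iff t x w).1 h'))]
    refine le_trans ?_ le_add_self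
    rw [e, zero_sub, enorm_neg]
    refine (ker0_bound hn hm hM hΩb t z w hz).trans ?_
    gcongr
    exact (prod_le_SA t z x w h1).trans le_add_self

lemma SA_int {n m : ℕ} (t : ℝ) (x z : EuclideanSpace ℝ (Fin n))
    (g : Fin m → EuclideanSpace ℝ (Fin n) → ℝ) (hg : ∀ i, AEStronglyMeasurable (g i) volume) :
    ∫⁻ w : Fin m → EuclideanSpace ℝ (Fin n), SA n m t x z w * ∏ i, ‖g i (w i)‖ₑ =
     ∑ j, ∏ i, if i = j then ∫⁻ y, AN n t x z y * ‖g i y‖ₑ else ∫⁻ y, QQ n t (n - 1) x y * ‖g i y‖ₑ := by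
  unfold SA
  have hmeas : ∀ j i, AEMeasurable (fun y => (if i = j then AN n t x z else QQ n t (n - 1) x) y * ‖g i y‖ₑ) volume := by
    intro j i
    split_ifs
    · exact (AN_meas n t x z).aemeasurable.mul (hg i).enorm
    · exact (QQ_meas n t _ x).aemeasurable.mul (hg i).enorm
  simp_rw [Finset.sum_mul, ← Finset.prod_mul_distrib]
  rw [lintegral_finsetSum']
  · apply Finset.sum_congr rfl
    intro j _
    rw [lintegral_pi_prod n m (fun i y => (if i = j then AN n t x z else QQ n t (n - 1) x) y * ‖g i y‖ₑ) (hmeas j)]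
    apply Finset.prod_congr rfl
    intro i _
    split_ifs <;> rfl
  · intro j _
    refine Finset.aemeasurable_fun_prod _ fun i _ => ?_
    exact (hmeas j i).comp_quasiMeasurePreserving (Measure.quasiMeasurePreserving_eval _ i)

lemma QQ_int {n m : ℕ} (t b : ℝ) (x : EuclideanSpace ℝ (Fin n))
    (g : Fin m → EuclideanSpace ℝ (Fin n) → ℝ) (hg : ∀ i, AEStronglyMeasurable (g i) volume) :
    ∫⁻ w : Fin m → EuclideanSpace ℝ (Fin n), (∏ i, QQ n t b x (w i)) * ∏ i, ‖g i (w i)‖ₑ =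
     ∏ i, ∫⁻ y, QQ n t b x y * ‖g i y‖ₑ := by
  simp_rw [← Finset.prod_mul_distrib]
  exact lintegral_pi_prod n m (fun i y => QQ n t b x y * ‖g i y‖ₑ) fun i =>
     (QQ_meas n t _ x).aemeasurable.mul (hg i).enorm

lemma QQ_prod_meas {n m : ℕ} (t b : ℝ) (x : EuclideanSpace ℝ (Fin n)) :
    Measurable (fun w : Fin m → EuclideanSpace ℝ (Fin n) => ∏ i, QQ n t b x (w i)) :=
  Finset.measurable_fun_prod _ fun i _ => (QQ_meas n t b x).comp (measurable_pi_apply i)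

lemma SA_meas {n m : ℕ} (t : ℝ) (x z : EuclideanSpace ℝ (Fin n)) : Measurable (SA n m t x z) := by
  unfold SA
  refine Finset.measurable_fun_sum _ fun j _ => Finset.measurable_fun_prod _ fun i _ => ?_
  split_ifs
  · exact (AN_meas n t x z).comp (measurable_pi_apply i)
  · exact (QQ_meas n t _ x).comp (measurable_pi_apply i)

lemma int_diff {n m : ℕ} (hn : 1 ≤ n) (hm : 1 ≤ m) {Ω : (Fin m → EuclideanSpace ℝ (Fin n)) → ℝ} {M β C₀ : ℝ}
    (hβ0 : 0 < β) (hβ1 : β < 1) (hC₀ : 0 < C₀)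
    (hM : 0 < M) (hΩb : ∀ u, u ≠ 0 → |Ω u| ≤ M)
    (hΩlip : ∀ ξ η : Fin m → EuclideanSpace ℝ (Fin n), ξ ≠ 0 → η ≠ 0 →
      |Ω ξ - Ω η| ≤ C₀ * ‖(∑ i, ‖ξ i‖)⁻¹ • ξ - (∑ i, ‖η i‖)⁻¹ • η‖ ^ β)
    (t : ℝ) (x z : EuclideanSpace ℝ (Fin n))
    (g : Fin m → EuclideanSpace ℝ (Fin n) → ℝ) (hg : ∀ i, AEStronglyMeasurable (g i) volume)
    (hJx : ∀ i, ∫⁻ y, QQ n t (n - 1) x y * ‖g i y‖ₑ < ⊤)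
    (hJz : ∀ i, ∫⁻ y, QQ n t (n - 1) z y * ‖g i y‖ₑ < ⊤) :
    ‖(∫ w : Fin m → EuclideanSpace ℝ (Fin n), ker0 n m Ω t ((fun _ => x) - w) * ∏ i, g i (w i)) -
      ∫ w : Fin m → EuclideanSpace ℝ (Fin n), ker0 n m Ω t ((fun _ => z) - w) * ∏ i, g i (w i)‖ₑ ≤
      ENNReal.ofReal ((2 * C₀ + (m * (n - 1) : ℕ) * M) * (m * ‖x - z‖) ^ β) *
        (∏ i, (∫⁻ y, QQ n t (n - 1 + β / m) x y * ‖g i y‖ₑ) + ∏ i, ∫⁻ y, QQ n t (n - 1 + β / m) z y * ‖g i y‖ₑ) +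
      ENNReal.ofReal M *
       ((∑ j, ∏ i, if i = j then ∫⁻ y, AN n t x z y * ‖g i y‖ₑ else ∫⁻ y, QQ n t (n - 1) x y * ‖g i y‖ₑ) +
       ∑ j, ∏ i, if i = j then ∫⁻ y, AN n t z x y * ‖g i y‖ₑ else ∫⁻ y, QQ n t (n - 1) z y * ‖g i y‖ₑ) := by
  have hΩ := omega_meas hβ0 hΩlip
  rw [← integral_sub (ker0_integrable hn hm hΩ hM hΩb t x g hg hJx) (ker0_integrable hn hm hΩ hM hΩb t z g hg hJz)]
  refine (enorm_integral_le_lintegral_enorm _).trans ?_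
  have hG : AEMeasurable (fun w : Fin m → EuclideanSpace ℝ (Fin n) => ∏ i, ‖g i (w i)‖ₑ) volume := by
    have := (prod_aesm hg).enorm
    simpa only [enorm_fin_prod] using this
  have hq := fun b y => QQ_prod_meas (n := n) (m := m) t b y
  have hs := fun x z => SA_meas (n := n) (m := m) t x z
  calc _ ≤ ∫⁻ w : Fin m → EuclideanSpace ℝ (Fin n), (ENNReal.ofReal ((2 * C₀ + (m * (n - 1) : ℕ) * M) * (m * ‖x - z‖) ^ β) *
        ((∏ i, QQ n t (n - 1 + β / m) x (w i)) * (∏ i, ‖g i (w i)‖ₑ) + (∏ i, QQ n t (n - 1 + β / m) z (w i)) * (∏ i, ‖g i (w i)‖ₑ)) +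
      ENNReal.ofReal M * (SA n m t x z w * (∏ i, ‖g i (w i)‖ₑ) + SA n m t z x w * (∏ i, ‖g i (w i)‖ₑ))) := by
        apply lintegral_mono_ae
        filter_upwards [ae_ne hn x, ae_ne hn z] with w hw hw'
        rw [← sub_mul, enorm_mul, enorm_fin_prod]
        rw [← add_mul, ← add_mul, ← mul_assoc, ← mul_assoc, ← add_mul]
        gcongr
        exact ker0_diff hn hm hβ0 hβ1 hC₀ hM hΩb hΩlip t x z w hw hw'
    _ = _ := by
        rw [lintegral_add_left', lintegral_const_mul', lintegral_const_mul', lintegral_add_left', lintegral_add_left',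
          QQ_int t _ x g hg, QQ_int t _ z g hg, SA_int t x z g hg, SA_int t z x g hg]
        · exact (hs _ _).aemeasurable.mul hG
        · exact (hq _ _).aemeasurable.mul hG
        · exact ENNReal.ofReal_ne_top
        · exact ENNReal.ofReal_ne_top
        · exact (((hq _ _).aemeasurable.mul hG).add ((hq _ _).aemeasurable.mul hG)).const_mul _


lemma QQ_osc (n : ℕ) (b δ : ℝ) (hb : 0 ≤ b) (hδ : 0 < δ) (h : b + δ < n) : ∃ C > (0:ℝ),
    ∀ f : EuclideanSpace ℝ (Fin n) → ℝ, LocallyIntegrable f volume → bmoNorm n f < ⊤ →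
    ∀ x₀ t, 0 < t → ∀ x, dist x x₀ ≤ 2 * t →
    ∫⁻ y, QQ n t b x y * ‖f y - ballAvg n f x₀ (4 * t)‖ₑ ≤
      ENNReal.ofReal (C * (bmoNorm n f).toReal * t ^ ((n:ℝ) - b)) := by
  obtain ⟨A, hA, HA⟩ := osc_growth n δ hδ
  obtain ⟨C, hC, HC⟩ := frac_int n b δ hb h
  refine ⟨A * C, by positivity, ?_⟩
  intro f hf hN x₀ t ht x hx
  have h1 := HC (fun y => ‖f y - ballAvg n f x₀ (4 * t)‖ₑ)
    (hf.aestronglyMeasurable.sub aestronglyMeasurable_const).enorm x t (A * (bmoNorm n f).toReal) ht (by positivity)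
    (fun s hs hst => HA f hf hN x₀ t ht x hx s hs hst)
  have e : ∫⁻ y, QQ n t b x y * ‖f y - ballAvg n f x₀ (4 * t)‖ₑ =
     ∫⁻ y in closedBall x t, ENNReal.ofReal (‖x - y‖ ^ (-b)) * ‖f y - ballAvg n f x₀ (4 * t)‖ₑ := by
    rw [← lintegral_indicator measurableSet_closedBall]
    congr 1
    ext y
    unfold QQ
    simp only [Set.indicator]
    split_ifs <;> simp
  rw [e]
  refine h1.trans (le_of_eq ?_)
  congr 1
  ring

lemma QQ_one (n : ℕ) (b : ℝ) (hb : 0 ≤ b) (h : b < n) (t : ℝ) (ht : 0 < t) (x : EuclideanSpace ℝ (Fin n)) :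
    ∫⁻ y, QQ n t b x y < ⊤ := by
  obtain ⟨C, hC, HC⟩ := frac_int n b 0 hb (by linarith)
  have h1 := HC (fun _ => 1) aemeasurable_const x t (volume (closedBall (0 : EuclideanSpace ℝ (Fin n)) 1)).toReal ht (by positivity) ?_
  · unfold QQ
    rw [lintegral_indicator measurableSet_closedBall]
    simp only [mul_one] at h1
    exact h1.trans_lt ENNReal.ofReal_lt_top
  · intro s hs hst
    rw [setLIntegral_const, one_mul, vol_cb _ _ _ hs.le, Real.rpow_zero, mul_one, mul_comm,
      ENNReal.ofReal_mul (by positivity), ENNReal.ofReal_toReal measure_closedBall_lt_top.ne]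


lemma AN_osc (n : ℕ) (hn : 1 ≤ n) (β δ : ℝ) (hδ : 0 < δ) (h : β + δ ≤ 1) : ∃ C > (0:ℝ),
    ∀ f : EuclideanSpace ℝ (Fin n) → ℝ, LocallyIntegrable f volume → bmoNorm n f < ⊤ →
    ∀ x₀ r t, 0 < r → 8 * r ≤ t → ∀ x ∈ closedBall x₀ r, ∀ z ∈ closedBall x₀ r,
    ∫⁻ y, AN n t x z y * ‖f y - ballAvg n f x₀ (4 * t)‖ₑ ≤
      ENNReal.ofReal (C * (bmoNorm n f).toReal * (t * (r / t) ^ β)) := by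
  obtain ⟨A, hA, HA⟩ := osc_growth n δ hδ
  refine ⟨2 ^ ((n:ℝ) - 1) * (4 * n * 2 ^ n) * A, by positivity, ?_⟩
  intro f hf hN x₀ r t hr hrt x hx z hz
  have ht : 0 < t := by linarith
  rw [mem_closedBall] at hx hz
  have hxz : dist x z ≤ 2 * r := by
    have := dist_triangle_right x z x₀
    linarith
  have hn1 : (1 : ℝ) ≤ n := by exact_mod_cast hn
  have h1 := annulus_int n (fun y => ‖f y - ballAvg n f x₀ (4 * t)‖ₑ)
    (hf.aestronglyMeasurable.sub aestronglyMeasurable_const).enorm x z t r hr hrt hxz (A * (bmoNorm n f).toReal * (r ^ n * (t / r) ^ δ)) ?_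
  · calc _ ≤ ∫⁻ y, (closedBall x t \ closedBall z t).indicator (fun y => ENNReal.ofReal ((t / 2) ^ (-((n:ℝ) - 1))) * ‖f y - ballAvg n f x₀ (4 * t)‖ₑ) y := by
          apply lintegral_mono
          intro y
          dsimp only
          by_cases hy : y ∈ closedBall x t \ closedBall z t
          · rw [Set.indicator_of_mem hy]
            rw [AN, Set.indicator_of_mem hy.2, QQ, Set.indicator_of_mem hy.1]
            gcongr ENNReal.ofReal ?_ * _
            apply Real.rpow_le_rpow_of_nonpos (by positivity) _ (by linarith)
            have h2 := hy.2
            rw [mem_closedBall, not_le] at h2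
            rw [← dist_eq_norm]
            have := dist_triangle y x z
            rw [dist_comm y x] at this
            linarith
          · rw [Set.indicator_of_notMem hy]
            have : AN n t x z y = 0 := by
              unfold AN QQ
              simp only [Set.indicator]
              split_ifs with h1 h2
              · exact absurd ⟨h2, h1⟩ hy
              · rfl
              · rfl
            simp [this]
      _ = ENNReal.ofReal ((t / 2) ^ (-((n:ℝ) - 1))) * ∫⁻ y in closedBall x t \ closedBall z t, ‖f y - ballAvg n f x₀ (4 * t)‖ₑ := by
          rw [lintegral_indicator (measurableSet_closedBall.diff measurableSet_closedBall), lintegral_const_mul' _ _ ENNReal.ofReal_ne_top]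
      _ ≤ _ := by
          refine (mul_le_mul_right h1 _).trans ?_
          rw [← ENNReal.ofReal_mul (by positivity)]
          apply ENNReal.ofReal_le_ofReal
          have hq : (r / t) * (t / r) ^ δ ≤ (r / t) ^ β := by
            have hrt0 : 0 < r / t := by positivity
            have e : (t / r) ^ δ = (r / t) ^ (-δ) := by
              rw [Real.rpow_neg hrt0.le, ← Real.inv_rpow hrt0.le, inv_div]
            rw [e]
            nth_rewrite 1 [← Real.rpow_one (r / t)]
            rw [← Real.rpow_add hrt0]
            apply Real.rpow_le_rpow_of_exponent_ge hrt0 _ (by linarith)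
            rw [div_le_one ht]; linarith
          have e2 : (t / 2) ^ (-((n:ℝ) - 1)) = 2 ^ ((n:ℝ) - 1) * (t / t ^ n) := by
            rw [Real.rpow_neg (by positivity), Real.div_rpow ht.le (by norm_num), inv_div, Real.rpow_sub ht,
              Real.rpow_natCast, Real.rpow_one]
            field_simp
          rw [e2, div_pow]
          have hr0 : r ^ n ≠ 0 := by positivity
          have ht0 : t ^ n ≠ 0 := by positivity
          calc _ = 2 ^ ((n:ℝ) - 1) * (4 * n * 2 ^ n) * A * (bmoNorm n f).toReal * (t * ((r / t) * (t / r) ^ δ)) * ((t ^ n / t ^ n) * (r ^ n / r ^ n)) := by ring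
            _ = 2 ^ ((n:ℝ) - 1) * (4 * n * 2 ^ n) * A * (bmoNorm n f).toReal * (t * ((r / t) * (t / r) ^ δ)) := by
                rw [div_self hr0, div_self ht0]; ring
            _ ≤ _ := by gcongr
  · intro w hw
    apply HA f hf hN x₀ t ht w _ r hr (by linarith)
    have := dist_triangle w x x₀
    linarith


lemma mFt_diff (n m : ℕ) (hn : 1 ≤ n) (hm : 1 ≤ m)
    (Ω : (Fin m → EuclideanSpace ℝ (Fin n)) → ℝ)
    (β C₀ : ℝ) (hβ0 : 0 < β) (hβ1 : β < 1) (hC₀ : 0 < C₀)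
    (hΩhom : ∀ l : ℝ, 0 < l → ∀ y : Fin m → EuclideanSpace ℝ (Fin n), Ω (l • y) = Ω y)
    (hΩlip : ∀ ξ η : Fin m → EuclideanSpace ℝ (Fin n), ξ ≠ 0 → η ≠ 0 →
      |Ω ξ - Ω η| ≤ C₀ * ‖(∑ i, ‖ξ i‖)⁻¹ • ξ - (∑ i, ‖η i‖)⁻¹ • η‖ ^ β)
    (hΩvan : ∀ (j : Fin m) (y : Fin m → EuclideanSpace ℝ (Fin n)),
      ∫ z : sphere (0 : EuclideanSpace ℝ (Fin n)) 1,
        Ω (Function.update y j (z : EuclideanSpace ℝ (Fin n)))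
        ∂(volume : Measure (EuclideanSpace ℝ (Fin n))).toSphere = 0) :
    ∃ K > (0 : ℝ), ∀ f : Fin m → EuclideanSpace ℝ (Fin n) → ℝ,
      (∀ j, LocallyIntegrable (f j) volume) →
      (∀ j, bmoNorm n (f j) < ⊤) →
      ∀ (x₀ : EuclideanSpace ℝ (Fin n)) (r : ℝ), 0 < r →
      ∀ x ∈ closedBall x₀ r, ∀ z ∈ closedBall x₀ r, ∀ t, 8 * r ≤ t →
        |mFt n m Ω f t x - mFt n m Ω f t z| ≤ K * (r / t) ^ β * ∏ j, (bmoNorm n (f j)).toReal := by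
  obtain ⟨M, hM, hΩb⟩ := omega_bdd hβ0 hC₀ hΩlip
  have hΩ := omega_meas hβ0 hΩlip
  have hn1 : (1 : ℝ) ≤ n := by exact_mod_cast hn
  have hm1 : (1 : ℝ) ≤ m := by exact_mod_cast hm
  have hm0 : (0 : ℝ) < m := by linarith
  have hβm : β / m ≤ β := div_le_self hβ0.le hm1
  have hβm0 : 0 < β / m := by positivity
  obtain ⟨Ca, hCa, Ha⟩ := QQ_osc n ((n:ℝ) - 1) ((1 - β) / 2) (by linarith) (by linarith) (by linarith)
  obtain ⟨Cb, hCb, Hb⟩ := QQ_osc n ((n:ℝ) - 1 + β / m) ((1 - β) / 2) (by linarith) (by linarith) (by linarith)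
  obtain ⟨Cc, hCc, Hc⟩ := AN_osc n hn β ((1 - β) / 2) (by linarith) (by linarith)
  set D := max Ca Cc with hD
  have hDa : Ca ≤ D := le_max_left _ _
  have hDc : Cc ≤ D := le_max_right _ _
  have hD0 : 0 < D := lt_of_lt_of_le hCa hDa
  set C1 : ℝ := 2 * C₀ + (m * (n - 1) : ℕ) * M with hC1
  have hC10 : 0 < C1 := by positivity
  refine ⟨C1 * (m * 2) ^ β * (2 * Cb ^ m) + M * (2 * (m * D ^ m)), by positivity, ?_⟩
  intro f hf hN x₀ r hr x hx z hz t hrt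
  have ht : 0 < t := by linarith
  have hx' := hx
  have hz' := hz
  rw [mem_closedBall] at hx' hz'
  have hxz : ‖x - z‖ ≤ 2 * r := by
    rw [← dist_eq_norm]
    have := dist_triangle_right x z x₀
    linarith
  set g : Fin m → EuclideanSpace ℝ (Fin n) → ℝ := fun i y => f i y - ballAvg n (f i) x₀ (4 * t) with hgdef
  set N : Fin m → ℝ := fun j => (bmoNorm n (f j)).toReal with hNdef
  have hN0 : ∀ i, 0 ≤ N i := fun i => ENNReal.toReal_nonneg
  have hg : ∀ i, AEStronglyMeasurable (g i) volume := fun i =>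
    (hf i).aestronglyMeasurable.sub aestronglyMeasurable_const
  have ea : (n:ℝ) - ((n:ℝ) - 1) = 1 := by ring
  have eb : (n:ℝ) - ((n:ℝ) - 1 + β / m) = 1 - β / m := by ring
  have ha : ∀ y ∈ closedBall x₀ r, ∀ i, ∫⁻ w, QQ n t (n - 1) y w * ‖g i w‖ₑ ≤ ENNReal.ofReal (D * N i * t) := by
    intro y hy i
    rw [mem_closedBall] at hy
    have := Ha (f i) (hf i) (hN i) x₀ t ht y (by linarith)
    rw [ea, Real.rpow_one] at this
    refine this.trans (ENNReal.ofReal_le_ofReal ?_)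
    have := hN0 i
    change Ca * N i * t ≤ _
    gcongr
  have hb : ∀ y ∈ closedBall x₀ r, ∀ i, ∫⁻ w, QQ n t (n - 1 + β / m) y w * ‖g i w‖ₑ ≤ ENNReal.ofReal (Cb * N i * t ^ (1 - β / m)) := by
    intro y hy i
    rw [mem_closedBall] at hy
    have := Hb (f i) (hf i) (hN i) x₀ t ht y (by linarith)
    rw [eb] at this
    exact this
  have hc : ∀ y ∈ closedBall x₀ r, ∀ y' ∈ closedBall x₀ r, ∀ i, ∫⁻ w, AN n t y y' w * ‖g i w‖ₑ ≤ ENNReal.ofReal (D * N i * (t * (r / t) ^ β)) := by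
    intro y hy y' hy' i
    refine (Hc (f i) (hf i) (hN i) x₀ r t hr hrt y hy y' hy').trans (ENNReal.ofReal_le_ofReal ?_)
    have := hN0 i
    change Cc * N i * _ ≤ _
    gcongr
  have hJ : ∀ y ∈ closedBall x₀ r, ∀ i, ∫⁻ w, QQ n t (n - 1) y w * ‖g i w‖ₑ < ⊤ :=
    fun y hy i => (ha y hy i).trans_lt ENNReal.ofReal_lt_top
  have hfg : ∀ y ∈ closedBall x₀ r, mFt n m Ω f t y = mFt n m Ω g t y := by
    intro y hy
    have := mFt_sub_const hn hm hΩ hM hΩb hΩhom hΩvan t y g hg (hJ y hy)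
      (QQ_one n _ (by linarith) (by linarith) t ht y) (fun i => ballAvg n (f i) x₀ (4 * t))
    rw [← this]
    congr 1
    ext i y
    simp [hgdef]
  rw [hfg x hx, hfg z hz, mFt_eq, mFt_eq, ← mul_sub, abs_mul, abs_of_pos (Real.rpow_pos_of_pos ht _)]
  have hI := int_diff hn hm hβ0 hβ1 hC₀ hM hΩb hΩlip t x z g hg (hJ x hx) (hJ z hz)
  set P := ∏ j, N j with hP
  have hP0 : 0 ≤ P := Finset.prod_nonneg fun i _ => hN0 i
  have pb : ∀ y ∈ closedBall x₀ r, ∏ i, (∫⁻ w, QQ n t (n - 1 + β / m) y w * ‖g i w‖ₑ) ≤ ENNReal.ofReal (Cb ^ m * P * t ^ (m - β)) := by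
    intro y hy
    refine (Finset.prod_le_prod' fun i _ => hb y hy i).trans (le_of_eq ?_)
    rw [← ENNReal.ofReal_prod_of_nonneg (fun i _ => by have := hN0 i; positivity)]
    congr 1
    rw [Finset.prod_mul_distrib, Finset.prod_mul_distrib, Finset.prod_const, Finset.prod_const, Finset.card_univ, Fintype.card_fin,
      ← Real.rpow_mul_natCast ht.le]
    congr 2
    field_simp
  have pa : ∀ y ∈ closedBall x₀ r, ∀ y' ∈ closedBall x₀ r,
      (∑ j : Fin m, ∏ i, if i = j then ∫⁻ w, AN n t y y' w * ‖g i w‖ₑ else ∫⁻ w, QQ n t (n - 1) y w * ‖g i w‖ₑ) ≤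
        ENNReal.ofReal (m * (D ^ m * P * (t ^ m * (r / t) ^ β))) := by
    intro y hy y' hy'
    have : ∀ j ∈ (Finset.univ : Finset (Fin m)), (∏ i, if i = j then ∫⁻ w, AN n t y y' w * ‖g i w‖ₑ else ∫⁻ w, QQ n t (n - 1) y w * ‖g i w‖ₑ) ≤
        ENNReal.ofReal (D ^ m * P * (t ^ m * (r / t) ^ β)) := by
      intro j _
      calc _ ≤ ∏ i, ENNReal.ofReal (D * N i * t * (if i = j then (r / t) ^ β else 1)) := by
            apply Finset.prod_le_prod'
            intro i _
            split_ifs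
            · rw [mul_assoc]
              exact hc y hy y' hy' i
            · rw [mul_one]
              exact ha y hy i
        _ = _ := by
            rw [← ENNReal.ofReal_prod_of_nonneg (fun i _ => by have := hN0 i; positivity)]
            congr 1
            rw [Finset.prod_mul_distrib, Finset.prod_mul_distrib, Finset.prod_mul_distrib, Finset.prod_const, Finset.prod_const, Finset.card_univ, Fintype.card_fin,
              Finset.prod_ite_eq' Finset.univ j (fun _ => (r / t) ^ β)]
            simp only [Finset.mem_univ, if_true]
            ring
    refine (Finset.sum_le_card_nsmul _ _ _ this).trans (le_of_eq ?_)
    rw [Finset.card_univ, Fintype.card_fin, nsmul_eq_mul, ENNReal.ofReal_mul hm0.le, ENNReal.ofReal_natCast]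
  have hI2 : ‖(∫ w : Fin m → EuclideanSpace ℝ (Fin n), ker0 n m Ω t ((fun _ => x) - w) * ∏ i, g i (w i)) -
      ∫ w : Fin m → EuclideanSpace ℝ (Fin n), ker0 n m Ω t ((fun _ => z) - w) * ∏ i, g i (w i)‖ₑ ≤
      ENNReal.ofReal (C1 * (m * (2 * r)) ^ β * (Cb ^ m * P * t ^ (m - β) + Cb ^ m * P * t ^ (m - β)) +
        M * (m * (D ^ m * P * (t ^ m * (r / t) ^ β)) + m * (D ^ m * P * (t ^ m * (r / t) ^ β)))) := by
    refine hI.trans ?_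
    have hsplit : ∀ a b X Y : ℝ, 0 ≤ a → 0 ≤ b → 0 ≤ X → 0 ≤ Y → ENNReal.ofReal (a * (X + X) + b * (Y + Y)) =
        ENNReal.ofReal a * (ENNReal.ofReal X + ENNReal.ofReal X) + ENNReal.ofReal b * (ENNReal.ofReal Y + ENNReal.ofReal Y) := by
      intro a b X Y h1 h2 h3 h4
      rw [ENNReal.ofReal_add (by positivity) (by positivity), ENNReal.ofReal_mul h1, ENNReal.ofReal_mul h2,
        ENNReal.ofReal_add h3 h3, ENNReal.ofReal_add h4 h4]
    rw [hsplit _ _ _ _ (by positivity) hM.le (by positivity) (by positivity)]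
    gcongr
    · exact pb x hx
    · exact pb z hz
    · exact pa x hx z hz
    · exact pa z hz x hx
  rw [← ofReal_norm, ENNReal.ofReal_le_ofReal_iff (by positivity), Real.norm_eq_abs] at hI2
  calc _ ≤ t ^ (-(m:ℝ)) * _ := mul_le_mul_of_nonneg_left hI2 (by positivity)
    _ = _ := by
      have e1 : (m * (2 * r)) ^ β = ((m:ℝ) * 2) ^ β * r ^ β := by
        rw [← mul_assoc, Real.mul_rpow (by positivity) hr.le]
      have e2 : t ^ ((m:ℝ) - β) = t ^ m / t ^ β := by
        rw [Real.rpow_sub ht, Real.rpow_natCast]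
      have e3 : (r / t) ^ β = r ^ β / t ^ β := Real.div_rpow hr.le ht.le _
      have e4 : t ^ (-(m:ℝ)) = (t ^ m)⁻¹ := by rw [Real.rpow_neg ht.le, Real.rpow_natCast]
      have h1 : t ^ m ≠ 0 := by positivity
      have h2 : t ^ β ≠ 0 := by positivity
      rw [e1, e2, e3, e4]
      field_simp
      ring


lemma tail_int (β r : ℝ) (hβ : 0 < β) (hr : 0 < r) (K : ℝ) (hK : 0 ≤ K) :
    (∫⁻ t in Set.Ioi (8 * r : ℝ), (ENNReal.ofReal (K * (r / t) ^ β / Real.sqrt t)) ^ (2:ℝ)) ^ (1 / 2 : ℝ) ≤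
      ENNReal.ofReal (K * (1 / (2 * β)) ^ (1 / 2 : ℝ)) := by
  have h8 : 0 < 8 * r := by linarith
  have e : ∀ t ∈ Set.Ioi (8 * r : ℝ), (ENNReal.ofReal (K * (r / t) ^ β / Real.sqrt t)) ^ (2:ℝ) =
      ENNReal.ofReal ((K ^ 2 * r ^ (2 * β)) * t ^ (-(2 * β) - 1)) := by
    intro t ht
    have ht0 : 0 < t := h8.trans ht
    rw [ENNReal.ofReal_rpow_of_nonneg (by positivity) (by norm_num)]
    congr 1
    rw [Real.rpow_two, div_pow, mul_pow, Real.sq_sqrt ht0.le, Real.div_rpow hr.le ht0.le, div_pow,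
      Real.rpow_sub_one ht0.ne', Real.rpow_neg ht0.le, two_mul, Real.rpow_add hr, Real.rpow_add ht0]
    field_simp
  rw [setLIntegral_congr_fun measurableSet_Ioi e]
  have hintg := integrableOn_Ioi_rpow_of_lt (a := -(2 * β) - 1) (by linarith) h8
  rw [← ofReal_integral_eq_lintegral_ofReal (hintg.const_mul _)]
  · rw [integral_const_mul, integral_Ioi_rpow_of_lt (by linarith) h8]
    rw [ENNReal.ofReal_rpow_of_nonneg _ (by norm_num)]
    · apply ENNReal.ofReal_le_ofReal
      have e1 : K ^ 2 * r ^ (2 * β) * (-(8 * r) ^ (-(2 * β) - 1 + 1) / (-(2 * β) - 1 + 1)) =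
         (K ^ 2) * (8 ^ (-(2 * β)) * (1 / (2 * β))) := by
        rw [show -(2 * β) - 1 + 1 = -(2 * β) by ring, Real.mul_rpow (by norm_num) hr.le, Real.rpow_neg hr.le]
        have : r ^ (2 * β) ≠ 0 := by positivity
        field_simp
      rw [e1]
      calc (K ^ 2 * (8 ^ (-(2 * β)) * (1 / (2 * β)))) ^ (1 / 2 : ℝ) ≤ (K ^ 2 * (1 * (1 / (2 * β)))) ^ (1 / 2 : ℝ) := by
            gcongr
            exact Real.rpow_le_one_of_one_le_of_nonpos (by norm_num) (by linarith)
        _ = _ := by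
            rw [one_mul, Real.mul_rpow (by positivity) (by positivity), ← Real.sqrt_eq_rpow (K ^ 2), Real.sqrt_sq hK]
    · apply mul_nonneg (by positivity)
      apply div_nonneg_of_nonpos
      · have : 0 ≤ (8 * r) ^ (-(2 * β) - 1 + 1) := by positivity
        linarith
      · linarith
  · filter_upwards [ae_restrict_mem measurableSet_Ioi] with t ht
    have ht0 : 0 < t := h8.trans ht
    simp only [Pi.zero_apply]
    positivity

lemma mink {α : Type*} [MeasurableSpace α] (μ : Measure α) (a b d : α → ℝ≥0∞) (hd : Measurable d)
    (hab : ∀ᵐ t ∂μ, (a t) ^ (1 / 2 : ℝ) ≤ (b t) ^ (1 / 2 : ℝ) + d t) :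
    (∫⁻ t, a t ∂μ) ^ (1 / 2 : ℝ) ≤ (∫⁻ t, b t ∂μ) ^ (1 / 2 : ℝ) + (∫⁻ t, d t ^ (2:ℝ) ∂μ) ^ (1 / 2 : ℝ) := by
  obtain ⟨a', ha', hle, heq⟩ := exists_measurable_le_lintegral_eq μ a
  rw [heq]
  set b' : α → ℝ≥0∞ := fun t => (a' t) ^ (1 / 2 : ℝ) - d t with hb'
  have hbm : Measurable b' := (ha'.pow_const _).sub hd
  have h22 : ∀ s : ℝ≥0∞, (s ^ (1 / 2 : ℝ)) ^ (2:ℝ) = s := by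
    intro s
    rw [← ENNReal.rpow_mul]; norm_num
  calc (∫⁻ t, a' t ∂μ) ^ (1 / 2 : ℝ) ≤ (∫⁻ t, ((b' + d) t) ^ (2:ℝ) ∂μ) ^ (1 / 2 : ℝ) := by
        gcongr with t
        calc a' t = ((a' t) ^ (1 / 2 : ℝ)) ^ (2:ℝ) := (h22 _).symm
          _ ≤ _ := by
            gcongr
            exact le_tsub_add
    _ ≤ (∫⁻ t, (b' t) ^ (2:ℝ) ∂μ) ^ (1 / 2 : ℝ) + (∫⁻ t, d t ^ (2:ℝ) ∂μ) ^ (1 / 2 : ℝ) :=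
        ENNReal.lintegral_Lp_add_le hbm.aemeasurable hd.aemeasurable (by norm_num)
    _ ≤ _ := by
        gcongr ?_ ^ _ + _
        apply lintegral_mono_ae
        filter_upwards [hab] with t ht
        calc b' t ^ (2:ℝ) ≤ ((b t) ^ (1 / 2 : ℝ)) ^ (2:ℝ) := by
              gcongr
              rw [hb']
              simp only
              rw [tsub_le_iff_right]
              refine le_trans ?_ ht
              gcongr
              exact hle t
          _ = b t := h22 _

/-- oscillation bound for the truncated square function on a
ball, BMO data. -/
theorem stmt10 (n m : ℕ) (hn : 1 ≤ n) (hm : 1 ≤ m)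
    (Ω : (Fin m → EuclideanSpace ℝ (Fin n)) → ℝ)
    (β C₀ : ℝ) (hβ0 : 0 < β) (hβ1 : β < 1) (hC₀ : 0 < C₀)
    (hΩhom : ∀ l : ℝ, 0 < l → ∀ y : Fin m → EuclideanSpace ℝ (Fin n), Ω (l • y) = Ω y)
    (hΩlip : ∀ ξ η : Fin m → EuclideanSpace ℝ (Fin n), ξ ≠ 0 → η ≠ 0 →
      |Ω ξ - Ω η| ≤ C₀ * ‖(∑ i, ‖ξ i‖)⁻¹ • ξ - (∑ i, ‖η i‖)⁻¹ • η‖ ^ β)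
    (hΩvan : ∀ (j : Fin m) (y : Fin m → EuclideanSpace ℝ (Fin n)),
      ∫ z : sphere (0 : EuclideanSpace ℝ (Fin n)) 1,
        Ω (Function.update y j (z : EuclideanSpace ℝ (Fin n)))
        ∂(volume : Measure (EuclideanSpace ℝ (Fin n))).toSphere = 0) :
    ∃ C > (0 : ℝ), ∀ f : Fin m → EuclideanSpace ℝ (Fin n) → ℝ,
      (∀ j, LocallyIntegrable (f j) volume) →
      (∀ j, bmoNorm n (f j) < ⊤) →
      ∀ (x₀ : EuclideanSpace ℝ (Fin n)) (r : ℝ), 0 < r →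
      ∀ x ∈ closedBall x₀ r, ∀ z ∈ closedBall x₀ r,
        marcTail n m Ω f r x ≤ marcTail n m Ω f r z +
          ENNReal.ofReal (C * ∏ j, (bmoNorm n (f j)).toReal) := by
  obtain ⟨K, hK, H⟩ := mFt_diff n m hn hm Ω β C₀ hβ0 hβ1 hC₀ hΩhom hΩlip hΩvan
  refine ⟨K * (1 / (2 * β)) ^ (1 / 2 : ℝ), by positivity, ?_⟩
  intro f hf hN x₀ r hr x hx z hz
  set P := ∏ j, (bmoNorm n (f j)).toReal with hP
  have hP0 : 0 ≤ P := Finset.prod_nonneg fun i _ => ENNReal.toReal_nonneg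
  have hd : Measurable (fun t : ℝ => ENNReal.ofReal (K * P * (r / t) ^ β / Real.sqrt t)) := by fun_prop
  have hsq : ∀ (s t : ℝ), 0 < t → ENNReal.ofReal (s ^ 2 / t) ^ (1 / 2 : ℝ) = ENNReal.ofReal (|s| / Real.sqrt t) := by
    intro s t ht
    rw [ENNReal.ofReal_rpow_of_nonneg (by positivity) (by norm_num), ← Real.sqrt_eq_rpow, Real.sqrt_div (by positivity), Real.sqrt_sq_eq_abs]
  have h1 := mink (volume.restrict (Set.Ioi (8 * r))) (fun t => ENNReal.ofReal ((mFt n m Ω f t x) ^ 2 / t))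
    (fun t => ENNReal.ofReal ((mFt n m Ω f t z) ^ 2 / t)) _ hd ?_
  · unfold marcTail
    refine h1.trans ?_
    gcongr
    refine (tail_int β r hβ0 hr (K * P) (by positivity)).trans (le_of_eq ?_)
    congr 1
    ring
  · filter_upwards [ae_restrict_mem measurableSet_Ioi] with t ht
    have ht' : 8 * r < t := ht
    have ht0 : 0 < t := by linarith
    rw [hsq _ _ ht0, hsq _ _ ht0, ← ENNReal.ofReal_add (by positivity) (by positivity), ← add_div]
    apply ENNReal.ofReal_le_ofReal
    gcongr
    have h2 := H f hf hN x₀ r hr x hx z hz t ht'.le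
    have h3 := abs_sub_abs_le_abs_sub (mFt n m Ω f t x) (mFt n m Ω f t z)
    have h4 : K * P * (r / t) ^ β = K * (r / t) ^ β * P := by ring
    linarith
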